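/- arXiv:2107.09326 — 3 statements merged into one kernel-verified Lean document; each statement's English description precedes it below -/
import Mathlib

section
/- For any exponential sum P(t) = Σ_{j=1}^n c_j e^{i t x_j} with real frequencies, and exponents 0 < q < p ≤ ∞ with q ≤ 2, one has ‖P‖_{L^p[0,1]} ≤ (πn/2)^{2/q − 2/p} ‖P‖_{L^q[0,1]} (Nikolskii-type inequality). -/
open MeasureTheory ENNReal

noncomputable section NikAux
open Polynomial

def nsq (p : ℂ[X]) (K : ℕ) : ℝ := ∑ k ∈ Finset.range K, ‖p.coeff k‖ ^ 2

lemma rot_identity (a b : ℝ) (h : a ^ 2 + b ^ 2 = 1) (u v : ℂ) :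
    ‖(a : ℂ) * u - b * v‖ ^ 2 + ‖(b : ℂ) * u + a * v‖ ^ 2 = ‖u‖ ^ 2 + ‖v‖ ^ 2 := by
  simp only [Complex.sq_norm, Complex.normSq_apply]
  simp
  linear_combination (u.re ^ 2 + u.im ^ 2 + v.re ^ 2 + v.im ^ 2) * h

lemma nsq_shift (w : ℂ) (hw : ‖w‖ = 1) (u : ℂ[X]) (K : ℕ) :
    nsq (C w * (X * u)) K ≤ nsq u K := by
  cases K with
  | zero => simp [nsq]
  | succ K =>
    unfold nsq
    rw [Finset.sum_range_succ', Finset.sum_range_succ]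
    simp [coeff_C_mul, coeff_X_mul, hw]

lemma step_aux (f : ℂ[X]) (w : ℂ) (hw : ‖w‖ = 1) (φ : ℝ) (k : ℕ) :
    ∃ g r : ℂ[X], (∀ K, nsq g K + nsq r K ≤ nsq f K) ∧
      g.coeff 0 = (Real.cos φ : ℂ) ^ k * f.coeff 0 ∧ r.coeff 0 = 0 ∧
      g.natDegree ≤ f.natDegree + k ∧ r.natDegree ≤ f.natDegree + k ∧
      (∀ z, f.eval z = 0 → g.eval z = 0 ∧ r.eval z = 0) ∧
      (∀ z, w * z = 1 → g.eval z = (Real.cos (k * φ) : ℂ) * f.eval z ∧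
        r.eval z = (Real.sin (k * φ) : ℂ) * f.eval z) := by
  induction k with
  | zero => exact ⟨f, 0, by simp [nsq], by simp, by simp, by simp, by simp, by simp, by simp⟩
  | succ k ih =>
    obtain ⟨g, r, h1, h2, h3, h4, h5, h6, h7⟩ := ih
    refine ⟨C (Real.cos φ : ℂ) * g - C (Real.sin φ : ℂ) * r,
      C w * (X * (C (Real.sin φ : ℂ) * g + C (Real.cos φ : ℂ) * r)), ?_, ?_, ?_, ?_, ?_, ?_, ?_⟩
    · intro K
      refine le_trans ?_ (h1 K)
      refine le_trans (add_le_add le_rfl (nsq_shift w hw _ K)) ?_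
      unfold nsq
      rw [← Finset.sum_add_distrib, ← Finset.sum_add_distrib]
      apply le_of_eq
      apply Finset.sum_congr rfl
      intro i _
      rw [coeff_sub, coeff_add, coeff_C_mul, coeff_C_mul, coeff_C_mul, coeff_C_mul]
      exact rot_identity _ _ (Real.cos_sq_add_sin_sq φ) _ _
    · rw [coeff_sub, coeff_C_mul, coeff_C_mul, h2, h3]; ring
    · simp
    · refine (natDegree_sub_le _ _).trans (max_le ?_ ?_)
      · exact (natDegree_C_mul_le _ _).trans (by omega)
      · exact (natDegree_C_mul_le _ _).trans (by omega)
    · refine (natDegree_C_mul_le _ _).trans ?_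
      refine natDegree_mul_le.trans ?_
      have : (C (Real.sin φ : ℂ) * g + C (Real.cos φ : ℂ) * r).natDegree ≤ f.natDegree + k := by
        refine (natDegree_add_le _ _).trans (max_le ?_ ?_)
        · exact (natDegree_C_mul_le _ _).trans (by omega)
        · exact (natDegree_C_mul_le _ _).trans (by omega)
      rw [natDegree_X]; omega
    · intro z hz
      obtain ⟨e1, e2⟩ := h6 z hz
      simp [e1, e2]
    · intro z hz
      obtain ⟨e1, e2⟩ := h7 z hz
      have e : ((k + 1 : ℕ) : ℝ) * φ = k * φ + φ := by push_cast; ring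
      rw [e, Real.cos_add, Real.sin_add]
      simp only [eval_sub, eval_mul, eval_add, eval_C, eval_X, e1, e2]
      constructor
      · push_cast; ring
      · rw [← mul_assoc, hz]; push_cast; ring

lemma prod_aux {ι : Type*} [DecidableEq ι] (s : Finset ι) (z : ι → ℂ) (hz : ∀ j, ‖z j‖ = 1)
    (N : ℕ) (hN : 0 < N) :
    ∃ A : ℂ[X], A.natDegree ≤ s.card * N ∧
      A.coeff 0 = (Real.cos (Real.pi / (2 * N)) : ℂ) ^ (s.card * N) ∧
      (∀ j ∈ s, A.eval (z j) = 0) ∧ ∀ K, nsq A K ≤ 1 := by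
  induction s using Finset.induction_on with
  | empty =>
    refine ⟨1, by simp, by simp, by simp, ?_⟩
    intro K
    cases K with
    | zero => simp [nsq]
    | succ K =>
      unfold nsq
      rw [Finset.sum_range_succ']
      simp [coeff_one]
  | insert j s hj ih =>
    obtain ⟨A, h1, h2, h3, h4⟩ := ih
    obtain ⟨g, r, g1, g2, -, g4, -, g6, g7⟩ :=
      step_aux A (z j)⁻¹ (by simp [hz]) (Real.pi / (2 * N)) N
    rw [Finset.card_insert_of_notMem hj]
    refine ⟨g, ?_, ?_, ?_, ?_⟩
    · refine g4.trans ?_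
      rw [add_mul]; omega
    · rw [g2, h2, add_mul, pow_add]; ring
    · intro i hi
      rcases Finset.mem_insert.1 hi with rfl | hi
      · have hne : z i ≠ 0 := by
          intro h0; have := hz i; simp [h0] at this
        rw [(g7 (z i) (inv_mul_cancel₀ hne)).1]
        have : (N : ℝ) * (Real.pi / (2 * N)) = Real.pi / 2 := by
          have : (N : ℝ) ≠ 0 := by positivity
          field_simp
        rw [this]; simp
      · exact (g6 _ (h3 i hi)).1
    · intro K
      refine le_trans ?_ ((g1 K).trans (h4 K))
      have : 0 ≤ nsq r K := Finset.sum_nonneg fun _ _ => by positivity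
      linarith

def esum {n : ℕ} (c : Fin n → ℂ) (x : Fin n → ℝ) (t : ℝ) : ℂ :=
  ∑ j, c j * Complex.exp (Complex.I * t * x j)

lemma esum_cont {n : ℕ} (c : Fin n → ℂ) (x : Fin n → ℝ) : Continuous (esum c x) := by
  unfold esum; fun_prop

lemma discrete_aux {n : ℕ} (c : Fin n → ℂ) (x : Fin n → ℝ) (N : ℕ) (hN : 0 < N) (h s : ℝ) :
    Real.cos (Real.pi / (2 * N)) ^ (2 * (n * N)) * ‖esum c x s‖ ^ 2 ≤
      (1 - Real.cos (Real.pi / (2 * N)) ^ (2 * (n * N))) *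
      ∑ k ∈ Finset.range (n * N), ‖esum c x (s + (k + 1 : ℕ) * h)‖ ^ 2 := by
  obtain ⟨A, h1, h2, h3, h4⟩ := prod_aux (Finset.univ : Finset (Fin n))
    (fun j => Complex.exp (Complex.I * h * x j))
    (fun j => by
      rw [show Complex.I * (h : ℂ) * (x j : ℂ) = ((h * x j : ℝ) : ℂ) * Complex.I by
        push_cast; ring]
      exact Complex.norm_exp_ofReal_mul_I _) N hN
  rw [Finset.card_univ, Fintype.card_fin] at h1 h2
  set a := Real.cos (Real.pi / (2 * N)) with ha
  set M := n * N with hM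
  have key : ∑ k ∈ Finset.range (M + 1), A.coeff k * esum c x (s + (k : ℕ) * h) = 0 := by
    unfold esum
    simp_rw [Finset.mul_sum]
    rw [Finset.sum_comm]
    apply Finset.sum_eq_zero
    intro j _
    have := h3 j (Finset.mem_univ j)
    rw [eval_eq_sum_range' (Nat.lt_succ_of_le h1)] at this
    have h5 := congrArg (fun y => c j * Complex.exp (Complex.I * s * x j) * y) this
    simp only [mul_zero, Finset.mul_sum] at h5
    rw [← h5]
    apply Finset.sum_congr rfl
    intro k _
    rw [← Complex.exp_nat_mul]
    rw [show Complex.I * ((s + (k : ℕ) * h : ℝ) : ℂ) * (x j : ℂ) =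
      Complex.I * s * x j + (k : ℂ) * (Complex.I * h * x j) by push_cast; ring, Complex.exp_add]
    ring
  rw [Finset.sum_range_succ'] at key
  have hn := h4 (M + 1)
  unfold nsq at hn
  rw [Finset.sum_range_succ'] at hn
  have e0 : ‖A.coeff 0‖ ^ 2 = a ^ (2 * M) := by
    rw [h2, norm_pow, Complex.norm_real, ← pow_mul, mul_comm M 2, pow_mul, pow_mul a 2 M,
      Real.norm_eq_abs, sq_abs]
  have e1 : ‖A.coeff 0 * esum c x s‖ ≤ ∑ k ∈ Finset.range M,
      ‖A.coeff (k + 1)‖ * ‖esum c x (s + (k + 1 : ℕ) * h)‖ := by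
    have : A.coeff 0 * esum c x s = -∑ k ∈ Finset.range M,
        A.coeff (k + 1) * esum c x (s + (k + 1 : ℕ) * h) := by
      simp only [Nat.cast_zero, zero_mul, add_zero] at key
      linear_combination key
    rw [this, norm_neg]
    refine (norm_sum_le _ _).trans (le_of_eq ?_)
    simp
  calc a ^ (2 * M) * ‖esum c x s‖ ^ 2 = ‖A.coeff 0 * esum c x s‖ ^ 2 := by
        rw [norm_mul, mul_pow, e0]
    _ ≤ (∑ k ∈ Finset.range M,
      ‖A.coeff (k + 1)‖ * ‖esum c x (s + (k + 1 : ℕ) * h)‖) ^ 2 := by gcongr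
    _ ≤ (∑ k ∈ Finset.range M, ‖A.coeff (k + 1)‖ ^ 2) *
        ∑ k ∈ Finset.range M, ‖esum c x (s + (k + 1 : ℕ) * h)‖ ^ 2 :=
      Finset.sum_mul_sq_le_sq_mul_sq _ _ _
    _ ≤ _ := by
      apply mul_le_mul_of_nonneg_right _ (Finset.sum_nonneg fun _ _ => by positivity)
      linarith

lemma cos_bound (n N : ℕ) (hN : 0 < N) :
    1 - n * Real.pi ^ 2 / (4 * N) ≤ Real.cos (Real.pi / (2 * N)) ^ (2 * (n * N)) := by
  have hb := one_add_mul_le_pow (a := -Real.sin (Real.pi / (2 * N)) ^ 2)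
    (by nlinarith [Real.sin_sq_le_one (Real.pi / (2 * N))]) (n * N)
  rw [pow_mul, Real.cos_sq']
  refine le_trans ?_ (le_trans hb (le_of_eq (by ring)))
  have hs : Real.sin (Real.pi / (2 * N)) ^ 2 ≤ (Real.pi / (2 * N)) ^ 2 := by
    have := Real.sin_sq_le_sq (x := Real.pi / (2 * N))
    exact this
  have hN' : (0 : ℝ) < N := by exact_mod_cast hN
  have : (n : ℝ) * Real.pi ^ 2 / (4 * N) = (n * N) * (Real.pi / (2 * N)) ^ 2 := by
    field_simp; ring
  rw [this]
  push_cast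
  have := mul_le_mul_of_nonneg_left hs (show (0 : ℝ) ≤ n * N by positivity)
  linarith

lemma integrated_aux {n : ℕ} (c : Fin n → ℂ) (x : Fin n → ℝ) (N : ℕ) (hN : 0 < N) :
    (1 - n * Real.pi ^ 2 / (4 * N)) * ∫ s in (0 : ℝ)..(1 / (n * N + 1 : ℝ)), ‖esum c x s‖ ^ 2 ≤
      n * Real.pi ^ 2 / (4 * N) * ∫ s in (0 : ℝ)..1, ‖esum c x s‖ ^ 2 := by
  set h : ℝ := 1 / (n * N + 1 : ℝ) with hh
  set ε : ℝ := n * Real.pi ^ 2 / (4 * N) with hε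
  have hε0 : 0 ≤ ε := by positivity
  have hcont : Continuous fun s => ‖esum c x s‖ ^ 2 := by
    have := esum_cont c x; fun_prop
  have hh0 : 0 < h := by positivity
  have hpt : ∀ s, (1 - ε) * ‖esum c x s‖ ^ 2 ≤
      ε * ∑ k ∈ Finset.range (n * N), ‖esum c x (s + (k + 1 : ℕ) * h)‖ ^ 2 := by
    intro s
    have h1 := discrete_aux c x N hN h s
    have h2 := cos_bound n N hN
    refine le_trans (mul_le_mul_of_nonneg_right h2 (by positivity)) (h1.trans ?_)
    apply mul_le_mul_of_nonneg_right _ (Finset.sum_nonneg fun _ _ => by positivity)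
    linarith
  have hint : ∀ a b : ℝ, IntervalIntegrable (fun s => ‖esum c x s‖ ^ 2) volume a b :=
    fun a b => hcont.intervalIntegrable a b
  have hce := esum_cont c x
  have h3 := intervalIntegral.integral_mono_on (a := 0) (b := h) (μ := volume) hh0.le
    (f := fun s => (1 - ε) * ‖esum c x s‖ ^ 2)
    (g := fun s => ε * ∑ k ∈ Finset.range (n * N), ‖esum c x (s + (k + 1 : ℕ) * h)‖ ^ 2)
    (Continuous.intervalIntegrable (by fun_prop) _ _)
    (Continuous.intervalIntegrable (by fun_prop) _ _) (fun s _ => hpt s)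
  rw [intervalIntegral.integral_const_mul, intervalIntegral.integral_const_mul,
    intervalIntegral.integral_finsetSum
      (fun i _ => Continuous.intervalIntegrable (by fun_prop) _ _)] at h3
  refine h3.trans (mul_le_mul_of_nonneg_left ?_ hε0)
  have h4 : ∀ k : ℕ, ∫ s in (0 : ℝ)..h, ‖esum c x (s + (k + 1 : ℕ) * h)‖ ^ 2 =
      ∫ s in ((k + 1 : ℕ) : ℝ) * h..((k + 1 + 1 : ℕ) : ℝ) * h, ‖esum c x s‖ ^ 2 := by
    intro k
    rw [intervalIntegral.integral_comp_add_right (fun s => ‖esum c x s‖ ^ 2)]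
    congr 1
    · ring
    · push_cast; ring
  simp_rw [h4]
  rw [intervalIntegral.sum_integral_adjacent_intervals
    (a := fun k : ℕ => ((k + 1 : ℕ) : ℝ) * h) (fun k _ => hint _ _)]
  have e1 : ((n * N + 1 : ℕ) : ℝ) * h = 1 := by
    rw [hh]; push_cast; field_simp
  rw [e1]
  rw [← intervalIntegral.integral_add_adjacent_intervals (hint 0 (((0 + 1 : ℕ) : ℝ) * h)) (hint _ 1)]
  have : 0 ≤ ∫ s in (0 : ℝ)..((0 + 1 : ℕ) : ℝ) * h, ‖esum c x s‖ ^ 2 :=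
    intervalIntegral.integral_nonneg (by positivity) fun _ _ => by positivity
  linarith

open Filter Topology in
lemma endpoint {n : ℕ} (c : Fin n → ℂ) (x : Fin n → ℝ) :
    ‖esum c x 0‖ ^ 2 ≤ (Real.pi * n / 2) ^ 2 * ∫ s in (0 : ℝ)..1, ‖esum c x s‖ ^ 2 := by
  rcases Nat.eq_zero_or_pos n with rfl | hn
  · simp [esum]
  have hcont : Continuous fun s => ‖esum c x s‖ ^ 2 := by
    have := esum_cont c x; fun_prop
  set I := ∫ s in (0 : ℝ)..1, ‖esum c x s‖ ^ 2 with hI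
  set F : ℝ → ℝ := fun u => ∫ s in (0 : ℝ)..u, ‖esum c x s‖ ^ 2 with hF
  have hd : HasDerivAt F (‖esum c x 0‖ ^ 2) 0 :=
    intervalIntegral.integral_hasDerivAt_right (hcont.intervalIntegrable _ _)
      (hcont.stronglyMeasurableAtFilter _ _) hcont.continuousAt
  have hslope := hd.tendsto_slope_zero
  have hseq : Tendsto (fun N : ℕ => 1 / (n * N + 1 : ℝ)) atTop (𝓝[≠] 0) := by
    apply tendsto_nhdsWithin_of_tendsto_nhds_of_eventually_within
    · simp_rw [one_div]
      apply Filter.Tendsto.inv_tendsto_atTop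
      apply tendsto_atTop_add_const_right
      exact tendsto_natCast_atTop_atTop.const_mul_atTop (by positivity)
    · exact Eventually.of_forall fun N => by
        have : (0 : ℝ) < 1 / (n * N + 1 : ℝ) := by positivity
        exact this.ne'
  have hl := hslope.comp hseq
  have hinv : Tendsto (fun N : ℕ => (1 : ℝ) / N) atTop (𝓝 0) := tendsto_one_div_atTop_nhds_zero_nat
  have hL : Tendsto (fun N : ℕ => (1 - n * Real.pi ^ 2 / 4 * (1 / (N : ℝ))) *
      ((n * N + 1 : ℝ) * F (1 / (n * N + 1 : ℝ)))) atTop (𝓝 ((1 - n * Real.pi ^ 2 / 4 * 0) *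
        ‖esum c x 0‖ ^ 2)) := by
    apply (tendsto_const_nhds.sub (hinv.const_mul _)).mul
    refine hl.congr fun N => ?_
    simp [hF]
  have hR : Tendsto (fun N : ℕ => (n * Real.pi ^ 2 / 4 * (n + 1 / (N : ℝ))) * I) atTop
      (𝓝 ((n * Real.pi ^ 2 / 4 * (n + 0)) * I)) :=
    ((tendsto_const_nhds.add hinv).const_mul _).mul_const _
  have := le_of_tendsto_of_tendsto hL hR (by
    filter_upwards [eventually_gt_atTop 0] with N hN
    have h := integrated_aux c x N hN
    have hN' : (0 : ℝ) < N := by exact_mod_cast hN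
    have h2 := mul_le_mul_of_nonneg_left h (show (0 : ℝ) ≤ n * N + 1 by positivity)
    calc _ = (n * N + 1 : ℝ) * ((1 - n * Real.pi ^ 2 / (4 * N)) *
          ∫ s in (0 : ℝ)..(1 / (n * N + 1 : ℝ)), ‖esum c x s‖ ^ 2) := by
          simp only [hF]
          rw [show (n * Real.pi ^ 2 / 4 * (1 / (N : ℝ))) = n * Real.pi ^ 2 / (4 * N) by field_simp]
          ring
      _ ≤ _ := h2
      _ = _ := by rw [← hI]; field_simp)
  calc _ = (1 - n * Real.pi ^ 2 / 4 * 0) * ‖esum c x 0‖ ^ 2 := by ring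
    _ ≤ _ := this
    _ = _ := by ring

lemma esum_affine {n : ℕ} (c : Fin n → ℂ) (x : Fin n → ℝ) (t d s : ℝ) :
    esum (fun j => c j * Complex.exp (Complex.I * t * x j)) (fun j => d * x j) s =
      esum c x (t + d * s) := by
  unfold esum
  apply Finset.sum_congr rfl
  intro j _
  rw [mul_assoc, ← Complex.exp_add]
  congr 2
  push_cast; ring

lemma interior_bd {n : ℕ} (c : Fin n → ℂ) (x : Fin n → ℝ) (t : ℝ) (ht : t ∈ Set.Icc (0 : ℝ) 1) :
    ‖esum c x t‖ ^ 2 ≤ (Real.pi * n / 2) ^ 2 * ∫ s in (0 : ℝ)..1, ‖esum c x s‖ ^ 2 := by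
  have hcont : Continuous fun s => ‖esum c x s‖ ^ 2 := by
    have := esum_cont c x; fun_prop
  have key : ∀ d : ℝ, ‖esum c x t‖ ^ 2 ≤
      (Real.pi * n / 2) ^ 2 * ∫ s in (0 : ℝ)..1, ‖esum c x (t + d * s)‖ ^ 2 := by
    intro d
    have := endpoint (fun j => c j * Complex.exp (Complex.I * t * x j)) (fun j => d * x j)
    simp_rw [esum_affine] at this
    simpa using this
  have h1 := mul_le_mul_of_nonneg_left (key (1 - t)) (show 0 ≤ 1 - t by linarith [ht.2])
  have h2 := mul_le_mul_of_nonneg_left (key (-t)) ht.1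
  have e1 : (1 - t) * ∫ s in (0 : ℝ)..1, ‖esum c x (t + (1 - t) * s)‖ ^ 2 =
      ∫ s in t..1, ‖esum c x s‖ ^ 2 := by
    have := intervalIntegral.mul_integral_comp_add_mul (f := fun s => ‖esum c x s‖ ^ 2)
      (a := 0) (b := 1) (1 - t) t
    rw [this]; congr 1 <;> ring
  have e2 : (-t) * ∫ s in (0 : ℝ)..1, ‖esum c x (t + (-t) * s)‖ ^ 2 =
      ∫ s in t..0, ‖esum c x s‖ ^ 2 := by
    have := intervalIntegral.mul_integral_comp_add_mul (f := fun s => ‖esum c x s‖ ^ 2)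
      (a := 0) (b := 1) (-t) t
    rw [this]; congr 1 <;> ring
  rw [intervalIntegral.integral_symm 0 t] at e2
  rw [← intervalIntegral.integral_add_adjacent_intervals (hcont.intervalIntegrable 0 t)
    (hcont.intervalIntegrable t 1)]
  linear_combination h1 + h2 + (Real.pi * n / 2) ^ 2 * e1 - (Real.pi * n / 2) ^ 2 * e2

set_option maxHeartbeats 1000000 in
lemma nik_main {n : ℕ} (c : Fin n → ℂ) (x : Fin n → ℝ)
    (p q : ℝ≥0∞) (hq0 : 0 < q) (hqp : q < p) (hq2 : q ≤ 2) :
    eLpNorm (esum c x) p (volume.restrict (Set.Icc (0:ℝ) 1))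
      ≤ ENNReal.ofReal ((Real.pi * n / 2) ^ (2 / q.toReal - 2 / p.toReal)) *
        eLpNorm (esum c x) q (volume.restrict (Set.Icc (0:ℝ) 1)) := by
  have hcf := esum_cont c x
  set μ := volume.restrict (Set.Icc (0:ℝ) 1) with hμ
  obtain ⟨t0, ht0, hmax⟩ := isCompact_Icc.exists_isMaxOn (s := Set.Icc (0:ℝ) 1)
    ⟨0, by simp⟩ hcf.norm.continuousOn
  set S := ‖esum c x t0‖ with hS
  have hbd : ∀ᵐ t ∂μ, ‖esum c x t‖ ≤ S := by
    rw [hμ, ae_restrict_iff' measurableSet_Icc]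
    exact Filter.Eventually.of_forall fun t ht => hmax ht
  have hS2 := interior_bd c x t0 ht0
  rw [intervalIntegral.integral_of_le zero_le_one, ← integral_Icc_eq_integral_Ioc, ← hμ,
    ← hS] at hS2
  have hmem : ∀ r : ℝ≥0∞, MemLp (esum c x) r μ := fun r =>
    MemLp.of_bound hcf.aestronglyMeasurable S hbd
  have hqtop : q ≠ ∞ := hqp.ne_top
  have hq : 0 < q.toReal := ENNReal.toReal_pos hq0.ne' hqtop
  have hq2' : q.toReal ≤ 2 := by
    have := ENNReal.toReal_mono (by simp) hq2
    simpa using this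
  set C := Real.pi * n / 2 with hC
  have hC0 : 0 ≤ C := by positivity
  have hS0 : 0 ≤ S := norm_nonneg _
  rcases hS0.eq_or_lt with hSz | hSpos
  · have : esum c x =ᵐ[μ] 0 := by
      filter_upwards [hbd] with t ht
      rw [← hSz] at ht
      simpa using ht
    rw [eLpNorm_congr_ae this]
    simp
  have hint : ∀ r : ℝ, 0 ≤ r → Integrable (fun t => ‖esum c x t‖ ^ r) μ := by
    intro r hr
    have : Continuous fun t => ‖esum c x t‖ ^ r := hcf.norm.rpow_const fun _ => Or.inr hr
    exact this.integrableOn_Icc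
  have hcomp : ∀ r s : ℝ, 0 < r → r ≤ s → ∫ t, ‖esum c x t‖ ^ s ∂μ ≤
      S ^ (s - r) * ∫ t, ‖esum c x t‖ ^ r ∂μ := by
    intro r s hr hrs
    rw [← integral_const_mul]
    apply integral_mono_ae (hint s (by linarith)) ((hint r hr.le).const_mul _)
    filter_upwards [hbd] with t ht
    have : ‖esum c x t‖ ^ s = ‖esum c x t‖ ^ (s - r) * ‖esum c x t‖ ^ r := by
      rw [← Real.rpow_add_of_nonneg (norm_nonneg _) (by linarith) hr.le]; simp
    rw [this]
    gcongr
  set J := ∫ t, ‖esum c x t‖ ^ q.toReal ∂μ with hJ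
  have hJ0 : 0 ≤ J := integral_nonneg fun _ => by positivity
  have hSq : S ^ q.toReal ≤ C ^ 2 * J := by
    have h1 := hcomp q.toReal 2 hq hq2'
    simp only [Real.rpow_two] at h1
    have h2 : S ^ (2 - q.toReal) * S ^ q.toReal ≤ S ^ (2 - q.toReal) * (C ^ 2 * J) := by
      rw [← Real.rpow_add hSpos]
      simp only [sub_add_cancel, Real.rpow_two]
      calc _ ≤ _ := hS2
        _ ≤ C ^ 2 * (S ^ (2 - q.toReal) * J) := by gcongr
        _ = _ := by ring
    exact le_of_mul_le_mul_left h2 (by positivity)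
  rw [(hmem q).eLpNorm_eq_integral_rpow_norm hq0.ne' hqtop, ← hJ,
    ← ENNReal.ofReal_mul (by positivity)]
  have hpw : ∀ e : ℝ, (C ^ 2 * J) ^ e = C ^ (2 * e) * J ^ e := by
    intro e
    rw [Real.mul_rpow (by positivity) hJ0, ← Real.rpow_two, ← Real.rpow_mul hC0]
  rcases eq_or_ne p ∞ with rfl | hptop
  · rw [eLpNorm_exponent_top]
    refine (eLpNormEssSup_le_of_ae_bound hbd).trans (ENNReal.ofReal_le_ofReal ?_)
    have := Real.rpow_le_rpow (by positivity) hSq (inv_nonneg.2 hq.le)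
    rw [Real.rpow_rpow_inv hS0 hq.ne', hpw] at this
    simpa [div_eq_mul_inv] using this
  · have hqp' : q.toReal < p.toReal := (ENNReal.toReal_lt_toReal hqtop hptop).2 hqp
    have hp : 0 < p.toReal := hq.trans hqp'
    rw [(hmem p).eLpNorm_eq_integral_rpow_norm (hq0.trans hqp).ne' hptop]
    apply ENNReal.ofReal_le_ofReal
    have h1 := hcomp q.toReal p.toReal hq hqp'.le
    rw [← hJ] at h1
    set a := q.toReal
    set b := p.toReal
    have hJpos : 0 < J := by
      have : 0 < S ^ a := by positivity
      by_contra hneg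
      have : J = 0 := le_antisymm (not_lt.1 hneg) hJ0
      rw [this] at hSq
      linarith
    have h2 : S ^ (b - a) ≤ C ^ (2 * ((b - a) / a)) * J ^ ((b - a) / a) := by
      rw [← hpw]
      have := Real.rpow_le_rpow (by positivity) hSq
        (show 0 ≤ (b - a) / a from div_nonneg (by linarith) hq.le)
      rwa [← Real.rpow_mul hS0, mul_div_cancel₀ _ hq.ne'] at this
    have h3 : ∫ t, ‖esum c x t‖ ^ b ∂μ ≤ C ^ (2 * ((b - a) / a)) * J ^ (b / a) := by
      refine h1.trans ((mul_le_mul_of_nonneg_right h2 hJ0).trans (le_of_eq ?_))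
      rw [mul_assoc]
      congr 1
      nth_rewrite 2 [← Real.rpow_one J]
      rw [← Real.rpow_add hJpos]
      congr 1
      field_simp
      ring
    have h4 := Real.rpow_le_rpow (integral_nonneg fun _ => Real.rpow_nonneg (norm_nonneg _) _) h3 (inv_nonneg.2 hp.le)
    refine h4.trans (le_of_eq ?_)
    rw [Real.mul_rpow (Real.rpow_nonneg hC0 _) (Real.rpow_nonneg hJ0 _), ← Real.rpow_mul hC0, ← Real.rpow_mul hJ0]
    congr 2
    · field_simp
    · field_simp

end NikAux

/-- **Nikolskii-type inequality** for exponential sums (Erdélyi): for an exponential sum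
`P` of degree at most `n` with real frequencies, and `0 < q < p ≤ ∞` with `q ≤ 2`,
`‖P‖_{L^p[0,1]} ≤ (πn/2)^{2/q − 2/p} ‖P‖_{L^q[0,1]}` (norms on `[0,1]`, which are
normalized since the interval has length one; `2/p = 0` when `p = ∞`). -/
theorem nikolskii_inequality (n : ℕ) (c : Fin n → ℂ) (x : Fin n → ℝ)
    (p q : ℝ≥0∞) (hq0 : 0 < q) (hqp : q < p) (hq2 : q ≤ 2) :
    eLpNorm (fun t : ℝ => ∑ j, c j * Complex.exp (Complex.I * t * x j)) p
        (volume.restrict (Set.Icc (0:ℝ) 1))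
      ≤ ENNReal.ofReal ((Real.pi * n / 2) ^ (2 / q.toReal - 2 / p.toReal)) *
        eLpNorm (fun t : ℝ => ∑ j, c j * Complex.exp (Complex.I * t * x j)) q
          (volume.restrict (Set.Icc (0:ℝ) 1)) := by
  have h := nik_main c x p q hq0 hqp hq2
  exact h
end

section
/- There is an absolute constant C such that every exponential sum P(t) = Σ_{j=1}^ℓ c_j e^{i t x_j} with real frequencies x_j satisfies ‖P'‖_{L∞[0,1]} ≤ C (108 ℓ^5 + Σ_{j=1}^ℓ x_j²)^{1/2} ‖P‖_{L∞[0,1]} (Bernstein-type inequality). -/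
open Filter Topology in
lemma aux_turan : ∀ (n : ℕ) (c z : Fin n → ℂ) (M : ℝ), 0 ≤ M → (∀ j, ‖z j‖ = 1) →
    (∀ k : ℕ, k < n → ‖∑ j, c j * z j ^ k‖ ≤ M) →
    ∀ N : ℕ, ‖∑ j, c j * z j ^ N‖ ≤ M * 3 ^ N := by
  intro n
  induction n with
  | zero => intro c z M hM _ _ N; simp; positivity
  | succ n ih =>
    intro c z M hM hz hk
    set y := z (Fin.last n) with hy
    have key : ∀ k : ℕ, ∑ j : Fin n, (c j.castSucc * (z j.castSucc - y)) * z j.castSucc ^ k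
        = (∑ j, c j * z j ^ (k+1)) - y * ∑ j, c j * z j ^ k := by
      intro k
      rw [Fin.sum_univ_castSucc, Fin.sum_univ_castSucc, mul_add, Finset.mul_sum, ← hy]
      have : ∑ j : Fin n, (c j.castSucc * (z j.castSucc - y)) * z j.castSucc ^ k
        = ∑ j : Fin n, c j.castSucc * z j.castSucc ^ (k+1)
          - ∑ j : Fin n, y * (c j.castSucc * z j.castSucc ^ k) := by
        rw [← Finset.sum_sub_distrib]
        refine Finset.sum_congr rfl fun j _ => ?_
        ring
      rw [this]; ring
    have h2 := ih (fun j => c j.castSucc * (z j.castSucc - y)) (fun j => z j.castSucc) (2*M)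
      (by positivity) (fun j => hz _) (by
        intro k hkn
        rw [key k]
        refine (norm_sub_le _ _).trans ?_
        rw [norm_mul, hy, hz, one_mul]
        have := hk (k+1) (by omega)
        have := hk k (by omega)
        linarith)
    intro N
    induction N with
    | zero => simpa using hk 0 (by omega)
    | succ N ihN =>
      have h3 := h2 N
      rw [key N] at h3
      have h4 : ‖∑ j, c j * z j ^ (N+1)‖ ≤ ‖(∑ j, c j * z j ^ (N+1)) - y * ∑ j, c j * z j ^ N‖
          + ‖y * ∑ j, c j * z j ^ N‖ := by
        refine le_trans (le_of_eq ?_) (norm_add_le _ _)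
        rw [sub_add_cancel]
      rw [norm_mul y, hy, hz, one_mul, ← hy] at h4
      rw [pow_succ]
      linarith

lemma aux_growth (n : ℕ) (c : Fin n → ℂ) (x : Fin n → ℝ) (M : ℝ) (hM : 0 ≤ M)
    (h : ∀ t : ℝ, 0 ≤ t → t ≤ 1/2 → ‖∑ j, c j * Complex.exp (Complex.I * t * x j)‖ ≤ M)
    (t : ℝ) (ht : 0 ≤ t) :
    ‖∑ j, c j * Complex.exp (Complex.I * t * x j)‖ ≤ M * (3 * Real.exp (5/2 * n * t)) := by
  set N := ⌈2 * n * t⌉₊ with hN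
  have hN1 : 2 * n * t ≤ N := Nat.le_ceil _
  have hN2 : (N:ℝ) < 2 * n * t + 1 := Nat.ceil_lt_add_one (by positivity)
  have h3 : (3:ℝ) ^ N ≤ 3 * Real.exp (5/2 * n * t) := by
    have l3 : Real.log 3 ≤ 5/4 := by
      rw [Real.log_le_iff_le_exp (by norm_num)]
      have := Real.quadratic_le_exp_of_nonneg (x := 5/4) (by norm_num)
      have := Real.add_one_le_exp (1/4 : ℝ)
      have e1 := Real.exp_one_gt_d9
      have : Real.exp (5/4) = Real.exp 1 * Real.exp (1/4) := by
        rw [← Real.exp_add]; norm_num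
      nlinarith
    have l0 : 0 ≤ Real.log 3 := Real.log_nonneg (by norm_num)
    have e3 : Real.exp (Real.log 3) = 3 := Real.exp_log (by norm_num)
    calc (3:ℝ) ^ N = Real.exp (N * Real.log 3) := by
          rw [mul_comm, Real.exp_mul, e3, Real.rpow_natCast]
      _ ≤ Real.exp (Real.log 3 + 5/2 * n * t) := by
          apply Real.exp_le_exp.2
          have : (N:ℝ) * Real.log 3 ≤ (2 * n * t + 1) * Real.log 3 := by gcongr
          have h5 : 0 ≤ (n:ℝ) * t := by positivity
          nlinarith
      _ = _ := by rw [Real.exp_add, e3]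
  rcases Nat.eq_zero_or_pos n with rfl | hn
  · simp; positivity
  rcases ht.eq_or_lt with rfl | htp
  · have := h 0 le_rfl (by norm_num)
    refine this.trans ?_
    simp
    linarith
  have hn' : (1:ℝ) ≤ n := by exact_mod_cast hn
  have hNpos : (0:ℝ) < N := lt_of_lt_of_le (by positivity) hN1
  have hp : ∀ (k : ℕ) (j), Complex.exp (Complex.I * ((t / N : ℝ) : ℂ) * x j) ^ k
      = Complex.exp (Complex.I * ((k * (t / N) : ℝ) : ℂ) * x j) := by
    intro k j
    rw [← Complex.exp_nat_mul]
    congr 1; push_cast; ring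
  have := aux_turan n c (fun j => Complex.exp (Complex.I * ((t / N : ℝ) : ℂ) * x j)) M hM
    (fun j => by
      rw [mul_assoc, mul_comm, ← Complex.ofReal_mul, Complex.norm_exp_ofReal_mul_I]) (by
      intro k hk
      simp only [hp]
      apply h
      · positivity
      · have hk' : (k:ℝ) ≤ n := by exact_mod_cast hk.le
        rw [← mul_div_assoc, div_le_iff₀ hNpos]
        nlinarith) N
  simp only [hp] at this
  rw [mul_div_cancel₀ _ hNpos.ne'] at this
  exact this.trans (by gcongr)

open Filter Topology in
lemma aux_energy (α : ℝ) (hα : 0 < α) : ∀ (n : ℕ) (c : Fin n → ℂ) (x : Fin n → ℝ),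
    ∃ F : ℝ → ℝ, (∀ t : ℝ, HasDerivAt F
        (-(2 * α) * ‖∑ j, c j * Complex.exp ((Complex.I * x j - α) * t)‖ ^ 2) t) ∧
      Tendsto F atTop (𝓝 0) ∧ 0 ≤ F 0 ∧
      ∀ σ : ℝ, 0 ≤ σ → ‖∑ j, c j * (Complex.I * x j - σ)‖ ^ 2 ≤
        (∑ j, x j ^ 2 + n * (σ + 2 * α * n) ^ 2) * F 0 := by
  intro n
  induction n with
  | zero => intro c x; exact ⟨fun _ => 0, by intro t; simpa using hasDerivAt_const t (0:ℝ), by simp, by simp, by simp⟩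
  | succ n ih =>
    intro c x
    set y := x (Fin.last n) with hy
    set d : Fin n → ℂ := fun j => c j.castSucc * (Complex.I * (x j.castSucc - y)) /
      (Complex.I * (x j.castSucc - y) - 2 * α) with hd
    have hne : ∀ j : Fin n, Complex.I * ((x j.castSucc : ℂ) - y) - 2 * α ≠ 0 := by
      intro j hj
      have := congrArg Complex.re hj
      simp at this
      linarith
    have hd' : ∀ j, d j * (Complex.I * (x j.castSucc - y) - 2 * α) =
        c j.castSucc * (Complex.I * (x j.castSucc - y)) := by
      intro j; exact div_mul_cancel₀ _ (hne j)
    obtain ⟨G, hG1, hG2, hG3, hG4⟩ := ih d (fun j => x j.castSucc)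
    set Q : ℝ → ℂ := fun t => ∑ j, c j * Complex.exp ((Complex.I * x j - α) * t) with hQ
    set g : ℝ → ℂ := fun t => ∑ j : Fin n, d j * Complex.exp ((Complex.I * x j.castSucc - α) * t)
      with hg
    have hE : ∀ (r : ℝ) (t : ℝ), HasDerivAt (fun t : ℝ => Complex.exp ((Complex.I * r - α) * t))
        ((Complex.I * r - α) * Complex.exp ((Complex.I * r - α) * t)) t := by
      intro r t
      have h1 : HasDerivAt (fun t : ℝ => (Complex.I * r - α) * (t:ℂ)) ((Complex.I * r - α) * 1) t :=
        (Complex.ofRealCLM.hasDerivAt (x := t)).const_mul _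
      have := h1.cexp
      rw [mul_one, mul_comm (Complex.exp _)] at this
      exact this
    have hE0 : ∀ r : ℝ, Tendsto (fun t : ℝ => Complex.exp ((Complex.I * r - α) * t)) atTop (𝓝 0) := by
      intro r
      rw [tendsto_zero_iff_norm_tendsto_zero]
      have : (fun t : ℝ => ‖Complex.exp ((Complex.I * r - α) * t)‖) = fun t => Real.exp (-(α * t)) := by
        ext t
        rw [Complex.norm_exp]
        simp
      rw [this]
      exact Real.tendsto_exp_neg_atTop_nhds_zero.comp (tendsto_id.const_mul_atTop hα)
    have hQt : ∀ t, Q t = (∑ j : Fin n, c j.castSucc * Complex.exp ((Complex.I * x j.castSucc - α) * t))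
        + c (Fin.last n) * Complex.exp ((Complex.I * y - α) * t) := by
      intro t; simp only [hQ]; rw [Fin.sum_univ_castSucc]
    have hw : ∀ t, HasDerivAt (fun t => Q t - g t)
        ((Complex.I * y - α) * Q t - (α + Complex.I * y) * g t) t := by
      intro t
      have h1 : HasDerivAt (fun t => Q t - g t)
          ((∑ j, c j * ((Complex.I * x j - α) * Complex.exp ((Complex.I * x j - α) * t)))
          - ∑ j : Fin n, d j * ((Complex.I * x j.castSucc - α) *
            Complex.exp ((Complex.I * x j.castSucc - α) * t))) t := by
        apply HasDerivAt.sub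
        · exact HasDerivAt.fun_sum fun j _ => (hE (x j) t).const_mul (c j)
        · exact HasDerivAt.fun_sum fun j _ => (hE (x j.castSucc) t).const_mul (d j)
      convert h1 using 1
      rw [Fin.sum_univ_castSucc, hQt, mul_add, Finset.mul_sum]
      simp only [hg]
      rw [Finset.mul_sum, ← hy]
      have : ∑ j : Fin n, ((Complex.I * y - α) * (c j.castSucc * Complex.exp ((Complex.I * x j.castSucc - α) * t))
          - (α + Complex.I * y) * (d j * Complex.exp ((Complex.I * x j.castSucc - α) * t)))
        = ∑ j : Fin n, (c j.castSucc * ((Complex.I * x j.castSucc - α) * Complex.exp ((Complex.I * x j.castSucc - α) * t))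
          - d j * ((Complex.I * x j.castSucc - α) *
            Complex.exp ((Complex.I * x j.castSucc - α) * t))) := by
        refine Finset.sum_congr rfl fun j _ => ?_
        linear_combination Complex.exp ((Complex.I * x j.castSucc - α) * t) * hd' j
      rw [Finset.sum_sub_distrib, Finset.sum_sub_distrib] at this
      linear_combination this
    refine ⟨fun t => G t + ‖Q t - g t‖ ^ 2, ?_, ?_, ?_, ?_⟩
    · intro t
      refine ((hG1 t).fun_add (hw t).norm_sq).congr_deriv ?_
      symm
      change -(2 * α) * ‖Q t‖ ^ 2 = -(2 * α) * ‖g t‖ ^ 2 + _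
      rw [Complex.inner, ← Complex.normSq_eq_norm_sq, ← Complex.normSq_eq_norm_sq]
      simp [Complex.normSq_apply]
      ring
    · have h1 : Tendsto Q atTop (𝓝 0) := by
        have := tendsto_finsetSum Finset.univ fun j _ => (hE0 (x j)).const_mul (c j)
        simpa using this
      have h2 : Tendsto g atTop (𝓝 0) := by
        have := tendsto_finsetSum Finset.univ fun j _ => (hE0 (x (Fin.castSucc j))).const_mul (d j)
        simpa using this
      simpa using hG2.add ((h1.sub h2).norm.pow 2)
    · positivity
    · intro σ hσ
      have h5 := hG4 (σ + 2 * α) (by positivity)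
      set w := Q 0 - g 0 with hwdef
      have hid : ∑ j, c j * (Complex.I * x j - σ) = (Complex.I * y - σ) * w +
          ∑ j : Fin n, d j * (Complex.I * x j.castSucc - ((σ + 2 * α : ℝ) : ℂ)) := by
        rw [hwdef, hQt, Fin.sum_univ_castSucc, ← hy]
        simp only [hg, Complex.ofReal_zero, mul_zero, Complex.exp_zero, mul_one]
        have : ∑ j : Fin n, c j.castSucc * (Complex.I * x j.castSucc - σ) =
          ∑ j : Fin n, ((Complex.I * y - σ) * c j.castSucc - (Complex.I * y - σ) * d j +
            d j * (Complex.I * x j.castSucc - ((σ + 2 * α : ℝ) : ℂ))) := by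
          refine Finset.sum_congr rfl fun j _ => ?_
          push_cast
          linear_combination -hd' j
        rw [Finset.sum_add_distrib, Finset.sum_sub_distrib, ← Finset.mul_sum, ← Finset.mul_sum] at this
        rw [this]; ring
      rw [hid, Fin.sum_univ_castSucc, ← hy]
      set R := ∑ j : Fin n, d j * (Complex.I * x j.castSucc - ((σ + 2 * α : ℝ) : ℂ))
      set S := ∑ j : Fin n, x j.castSucc ^ 2
      have hS : 0 ≤ S := Finset.sum_nonneg fun j _ => sq_nonneg _
      have hA : ‖Complex.I * y - (σ:ℂ)‖ ^ 2 = y ^ 2 + σ ^ 2 := by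
        rw [← Complex.normSq_eq_norm_sq]; simp [Complex.normSq_apply]; ring
      set A := ‖Complex.I * y - (σ:ℂ)‖
      have h6 : ‖(Complex.I * y - σ) * w + R‖ ≤ A * ‖w‖ + ‖R‖ :=
        (norm_add_le _ _).trans (by rw [norm_mul])
      set B := S + n * (σ + 2 * α + 2 * α * n) ^ 2 with hB
      have hB0 : 0 ≤ B := by positivity
      have h7 : (A * ‖w‖ + ‖R‖) ^ 2 ≤ (A ^ 2 + B) * (‖w‖ ^ 2 + G 0) := by
        have e1 : ‖R‖ ≤ √B * √(G 0) := by
          rw [← Real.sqrt_mul hB0]; exact Real.le_sqrt_of_sq_le h5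
        have e2 := Real.sq_sqrt hB0
        have e3 := Real.sq_sqrt hG3
        have hA0 : 0 ≤ A := norm_nonneg _
        calc (A * ‖w‖ + ‖R‖) ^ 2 ≤ (A * ‖w‖ + √B * √(G 0)) ^ 2 := by gcongr
          _ ≤ (A ^ 2 + √B ^ 2) * (‖w‖ ^ 2 + √(G 0) ^ 2) := by
            nlinarith [sq_nonneg (A * √(G 0) - √B * ‖w‖)]
          _ = _ := by rw [e2, e3]
      calc ‖(Complex.I * y - σ) * w + R‖ ^ 2 ≤ (A * ‖w‖ + ‖R‖) ^ 2 := by gcongr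
        _ ≤ (A ^ 2 + B) * (‖w‖ ^ 2 + G 0) := h7
        _ = (A ^ 2 + B) * (G 0 + ‖w‖ ^ 2) := by ring
        _ ≤ _ := by
          apply mul_le_mul_of_nonneg_right _ (by positivity)
          rw [hA, hB]
          push_cast
          have : σ ^ 2 ≤ (σ + 2 * α * (n + 1)) ^ 2 := by
            gcongr
            have : 0 ≤ 2 * α * ((n:ℝ) + 1) := by positivity
            linarith
          nlinarith

open Filter Topology in
lemma aux_core (n : ℕ) (c : Fin n → ℂ) (x : Fin n → ℝ) (M : ℝ) (hM : 0 ≤ M)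
    (h : ∀ t : ℝ, 0 ≤ t → t ≤ 1/2 → ‖∑ j, c j * Complex.exp (Complex.I * t * x j)‖ ≤ M) :
    ‖∑ j, c j * (Complex.I * x j)‖ ≤ 5 * Real.sqrt (108 * (n : ℝ) ^ 5 + ∑ j, (x j) ^ 2) * M := by
  rcases Nat.eq_zero_or_pos n with rfl | hn
  · simp
  have hn' : (0:ℝ) < n := by exact_mod_cast hn
  obtain ⟨F, hF1, hF2, hF3, hF4⟩ := aux_energy (5 * n) (by positivity) n c x
  have hgr := aux_growth n c x M hM h
  have hQ : ∀ t : ℝ, 0 ≤ t → ‖∑ j, c j * Complex.exp ((Complex.I * x j - ((5 * n : ℝ) : ℂ)) * t)‖ ^ 2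
      ≤ 9 * M ^ 2 * Real.exp (-(5 * n * t)) := by
    intro t ht
    have e1 : ∑ j, c j * Complex.exp ((Complex.I * x j - ((5 * n : ℝ) : ℂ)) * t)
        = ((Real.exp (-(5 * n * t)) : ℝ) : ℂ) * ∑ j, c j * Complex.exp (Complex.I * t * x j) := by
      rw [Finset.mul_sum]
      refine Finset.sum_congr rfl fun j _ => ?_
      rw [Complex.ofReal_exp, mul_left_comm, ← Complex.exp_add]
      congr 2
      push_cast; ring
    rw [e1, norm_mul, Complex.norm_real, Real.norm_of_nonneg (Real.exp_pos _).le]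
    calc (Real.exp (-(5 * n * t)) * ‖∑ j, c j * Complex.exp (Complex.I * t * x j)‖) ^ 2
        ≤ (Real.exp (-(5 * n * t)) * (M * (3 * Real.exp (5/2 * n * t)))) ^ 2 := by
          gcongr; exact hgr t ht
      _ = 9 * M ^ 2 * (Real.exp (-(5 * n * t)) * Real.exp (5/2 * n * t)) ^ 2 := by ring
      _ = _ := by
        rw [← Real.exp_add, ← Real.exp_nat_mul]
        congr 2; push_cast; ring
  have hD : ∀ t : ℝ, HasDerivAt (fun t => F t - 18 * M ^ 2 * Real.exp (-(5 * n * t)))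
      (-(2 * (5 * n)) * ‖∑ j, c j * Complex.exp ((Complex.I * x j - ((5 * n : ℝ) : ℂ)) * t)‖ ^ 2
        - 18 * M ^ 2 * (Real.exp (-(5 * n * t)) * (-(5 * n * 1)))) t := by
    intro t
    exact (hF1 t).sub ((((hasDerivAt_id t).const_mul (5 * (n:ℝ))).neg.exp).const_mul (18 * M ^ 2))
  have hmono : MonotoneOn (fun t => F t - 18 * M ^ 2 * Real.exp (-(5 * n * t))) (Set.Ici 0) := by
    apply monotoneOn_of_deriv_nonneg (convex_Ici 0)
    · exact fun t _ => (hD t).continuousAt.continuousWithinAt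
    · exact fun t _ => (hD t).differentiableAt.differentiableWithinAt
    · intro t ht
      rw [(hD t).deriv]
      have ht0 : 0 ≤ t := by simpa using interior_subset ht
      have := hQ t ht0
      nlinarith
  have hlim : Tendsto (fun t => F t - 18 * M ^ 2 * Real.exp (-(5 * n * t))) atTop (𝓝 0) := by
    have h1 : Tendsto (fun t : ℝ => Real.exp (-(5 * n * t))) atTop (𝓝 0) :=
      Real.tendsto_exp_neg_atTop_nhds_zero.comp (tendsto_id.const_mul_atTop (by positivity))
    simpa using hF2.sub (h1.const_mul (18 * M ^ 2))
  have hF0 : F 0 ≤ 18 * M ^ 2 := by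
    have : F 0 - 18 * M ^ 2 * Real.exp (-(5 * n * 0)) ≤ 0 := by
      apply ge_of_tendsto hlim
      filter_upwards [eventually_ge_atTop 0] with t ht
      exact hmono (by simp) (by simpa using ht) ht
    simp at this
    linarith
  have h4 := hF4 0 le_rfl
  simp only [Complex.ofReal_zero, sub_zero, zero_add] at h4
  have hS : 0 ≤ ∑ j, x j ^ 2 := Finset.sum_nonneg fun j _ => sq_nonneg _
  apply (sq_le_sq₀ (norm_nonneg _) (by positivity)).1
  rw [mul_pow, mul_pow, Real.sq_sqrt (by positivity)]
  calc _ ≤ _ := h4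
    _ ≤ (108 * (n : ℝ) ^ 5 + ∑ j, (x j) ^ 2) * (25 * M ^ 2) := by
      apply mul_le_mul _ _ hF3 (by positivity)
      · have : 0 ≤ (n:ℝ) ^ 5 := by positivity
        nlinarith
      · nlinarith [sq_nonneg M]
    _ = _ := by ring

/-- **Bernstein-type inequality** for exponential sums (Erdélyi): there is an absolute
constant `C` such that every exponential sum `P(t) = ∑_{j=1}^ℓ c_j e^{i t x_j}` with real
frequencies satisfies
`‖P'‖_{L∞[0,1]} ≤ C (108 ℓ^5 + ∑ x_j²)^{1/2} ‖P‖_{L∞[0,1]}`. -/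
theorem bernstein_inequality :
    ∃ C : ℝ, 0 < C ∧
      ∀ (ℓ : ℕ) (c : Fin ℓ → ℂ) (x : Fin ℓ → ℝ), ∀ u ∈ Set.Icc (0:ℝ) 1,
        ‖deriv (fun t : ℝ => ∑ j, c j * Complex.exp (Complex.I * t * x j)) u‖ ≤
          C * Real.sqrt (108 * (ℓ : ℝ) ^ 5 + ∑ j, (x j) ^ 2) *
            sSup ((fun t : ℝ => ‖∑ j, c j * Complex.exp (Complex.I * t * x j)‖) ''
              Set.Icc (0:ℝ) 1) := by
  refine ⟨5, by norm_num, ?_⟩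
  intro ℓ c x u hu
  set P : ℝ → ℂ := fun t : ℝ => ∑ j, c j * Complex.exp (Complex.I * t * x j) with hP
  have hPc : Continuous P := by fun_prop
  set M := sSup ((fun t : ℝ => ‖P t‖) '' Set.Icc (0:ℝ) 1) with hMdef
  have hb : ∀ t ∈ Set.Icc (0:ℝ) 1, ‖P t‖ ≤ M := fun t ht =>
    le_csSup (isCompact_Icc.bddAbove_image hPc.norm.continuousOn) (Set.mem_image_of_mem _ ht)
  have hM : 0 ≤ M := (norm_nonneg _).trans (hb u hu)
  have hder : deriv P u = ∑ j, (c j * Complex.exp (Complex.I * u * x j)) * (Complex.I * x j) := by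
    apply HasDerivAt.deriv
    apply HasDerivAt.fun_sum
    intro j _
    have h1 : HasDerivAt (fun t : ℝ => Complex.I * (t:ℂ) * x j) (Complex.I * 1 * x j) u :=
      ((Complex.ofRealCLM.hasDerivAt (x := u)).const_mul _).mul_const _
    have := h1.cexp.const_mul (c j)
    rw [mul_one, ← mul_assoc] at this
    exact this
  change ‖deriv P u‖ ≤ _ * M
  rw [hder]
  have hsh : ∀ (t : ℝ) (s : ℝ), ∑ j, (c j * Complex.exp (Complex.I * u * x j)) *
      Complex.exp (Complex.I * t * ((s * x j : ℝ) : ℂ)) = P (u + s * t) := by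
    intro t s
    refine Finset.sum_congr rfl fun j _ => ?_
    rw [mul_assoc, ← Complex.exp_add]
    congr 2; push_cast; ring
  rcases le_total u (1/2) with hu2 | hu2
  · have := aux_core ℓ (fun j => c j * Complex.exp (Complex.I * u * x j)) (fun j => 1 * x j) M hM
      (by
        intro t h0 h1
        rw [hsh]
        exact hb _ ⟨by linarith [hu.1], by linarith⟩)
    simpa using this
  · have := aux_core ℓ (fun j => c j * Complex.exp (Complex.I * u * x j)) (fun j => -1 * x j) M hM
      (by
        intro t h0 h1
        rw [hsh]
        exact hb _ ⟨by linarith [hu.1], by linarith [hu.2]⟩)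
    simpa using this
end

section
/- There exist an absolute constant C' and a constant C(ℓ) (depending only on ℓ) such that for any exponential sum Q(u) = Σ_{j=1}^ℓ c_j e^{i N u x_j} with pairwise frequency differences satisfying |x_j − x_k| ≤ τΔ and τNΔ ≤ 2π, and any integer N ≥ C(ℓ), one has Σ_{k=0}^N |Q(k/N)|² ≥ (N/2) ∫_0^1 |Q(u)|² du. -/
open intervalIntegral in
lemma deb_energy (f u : ℝ → ℂ) (α lam L : ℝ) (hα : 0 < α)
    (hf : Continuous f)
    (hu : ∀ t, HasDerivAt u (((α : ℂ) + lam * Complex.I) * u t - f t) t) (huL : u L = 0) :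
    (∫ t in (0:ℝ)..L, ‖f t - α * u t‖ ^ 2) + α ^ 2 * (∫ t in (0:ℝ)..L, ‖u t‖ ^ 2)
      ≤ ∫ t in (0:ℝ)..L, ‖f t‖ ^ 2 := by
  have hcu : Continuous u := continuous_iff_continuousAt.2 fun t => (hu t).continuousAt
  have hd : ∀ t, HasDerivAt (fun t => ‖u t‖ ^ 2)
      (2 * inner ℝ (u t) (((α : ℂ) + lam * Complex.I) * u t - f t)) t := fun t => (hu t).norm_sq
  have hint := integral_eq_sub_of_hasDerivAt (a := 0) (b := L) (fun t _ => hd t)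
    (Continuous.intervalIntegrable (by fun_prop) _ _)
  have hpt : ∀ t, ‖f t - α * u t‖ ^ 2 + α ^ 2 * ‖u t‖ ^ 2 = ‖f t‖ ^ 2 +
      α * (2 * inner ℝ (u t) (((α : ℂ) + lam * Complex.I) * u t - f t)) := by
    intro t
    rw [Complex.inner]
    simp only [Complex.sq_norm, Complex.normSq_apply]
    simp
    ring
  rw [← integral_const_mul, ← integral_add (Continuous.intervalIntegrable (by fun_prop) _ _)
    (Continuous.intervalIntegrable (by fun_prop) _ _)]
  simp_rw [hpt]
  rw [integral_add (Continuous.intervalIntegrable (by fun_prop) _ _)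
    (Continuous.intervalIntegrable (by fun_prop) _ _), integral_const_mul, hint, huL]
  have : 0 ≤ α * ‖u 0‖ ^ 2 := by positivity
  simp
  linarith

lemma deb_restrict (g : ℝ → ℝ) (hg : Continuous g) (h0 : ∀ t, 0 ≤ g t) (L τ : ℝ) (hτ : 0 ≤ τ)
    (hL : τ ≤ L) : (∫ t in (0:ℝ)..(L-τ), g t) ≤ ∫ t in (0:ℝ)..L, g t :=
  intervalIntegral.integral_mono_interval le_rfl (by linarith) (by linarith)
    (Filter.Eventually.of_forall h0) (hg.intervalIntegrable _ _)

lemma deb_shift (g : ℝ → ℝ) (hg : Continuous g) (h0 : ∀ t, 0 ≤ g t) (L τ : ℝ) (hτ : 0 ≤ τ)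
    (hL : τ ≤ L) : (∫ t in (0:ℝ)..(L-τ), g (t + τ)) ≤ ∫ t in (0:ℝ)..L, g t := by
  rw [intervalIntegral.integral_comp_add_right]
  exact intervalIntegral.integral_mono_interval (by linarith) (by linarith) (by linarith)
    (Filter.Eventually.of_forall h0) (hg.intervalIntegrable _ _)

lemma deb_norm_add_sq (δ : ℝ) (hδ : 0 < δ) (x y : ℂ) :
    ‖x + y‖ ^ 2 ≤ (1 + δ) * ‖x‖ ^ 2 + (1 + 1 / δ) * ‖y‖ ^ 2 := by
  have h1 : ‖x + y‖ ^ 2 ≤ (‖x‖ + ‖y‖) ^ 2 := by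
    gcongr; exact norm_add_le _ _
  have h2 : (1 + δ) * ‖x‖ ^ 2 + (1 + 1 / δ) * ‖y‖ ^ 2 - (‖x‖ + ‖y‖) ^ 2
      = (δ * ‖x‖ - ‖y‖) ^ 2 / δ := by
    field_simp; ring
  have : 0 ≤ (δ * ‖x‖ - ‖y‖) ^ 2 / δ := by positivity
  linarith

lemma deb_int3 (A B C : ℝ) (p q r : ℝ → ℝ) (hp : Continuous p) (hq : Continuous q)
    (hr : Continuous r) (g : ℝ → ℝ) (hg : Continuous g) (b : ℝ) (hb : 0 ≤ b)
    (h : ∀ t, g t ≤ A * p t + B * q t + C * r t) :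
    (∫ t in (0:ℝ)..b, g t) ≤ A * (∫ t in (0:ℝ)..b, p t) + B * (∫ t in (0:ℝ)..b, q t)
      + C * (∫ t in (0:ℝ)..b, r t) := by
  rw [← intervalIntegral.integral_const_mul, ← intervalIntegral.integral_const_mul,
    ← intervalIntegral.integral_const_mul, ← intervalIntegral.integral_add
    (Continuous.intervalIntegrable (by fun_prop) _ _)
    (Continuous.intervalIntegrable (by fun_prop) _ _), ← intervalIntegral.integral_add
    (Continuous.intervalIntegrable (by fun_prop) _ _)
    (Continuous.intervalIntegrable (by fun_prop) _ _)]
  exact intervalIntegral.integral_mono hb (hg.intervalIntegrable _ _)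
    (Continuous.intervalIntegrable (by fun_prop) _ _) h

set_option maxHeartbeats 1000000 in
lemma deb_step (f u : ℝ → ℂ) (α lam L τ l a : ℝ) (θ : ℂ) (hα : 0 < α) (hlam : |lam| ≤ α)
    (hτ : 0 ≤ τ) (hL : τ ≤ L) (hf : Continuous f) (hl : 1 ≤ l)
    (hu : ∀ t, HasDerivAt u (((α : ℂ) + lam * Complex.I) * u t - f t) t) (huL : u L = 0)
    (hθ : ‖θ‖ ≤ 1 / (4 * l)) (ha : a * (1 - ‖θ‖) = α) :
    (∫ t in (0:ℝ)..(L-τ), ‖f t - a * (u t - θ * u (t + τ))‖ ^ 2)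
        ≤ (1 + 2 / l) * ∫ t in (0:ℝ)..L, ‖f t‖ ^ 2 ∧
    (∫ t in (0:ℝ)..(L-τ), ‖(a : ℂ) * (((α : ℂ) + lam * Complex.I) * (u t - θ * u (t + τ)) - f t
          + θ * f (t + τ))‖ ^ 2)
        ≤ (60 * α ^ 2) * ∫ t in (0:ℝ)..L, ‖f t‖ ^ 2 := by
  have hL0 : 0 ≤ L := hτ.trans hL
  have hcu : Continuous u := continuous_iff_continuousAt.2 fun t => (hu t).continuousAt
  have hE := deb_energy f u α lam L hα hf hu huL
  set F := ∫ t in (0:ℝ)..L, ‖f t‖ ^ 2 with hF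
  set U := ∫ t in (0:ℝ)..L, ‖u t‖ ^ 2 with hU
  have hF0 : 0 ≤ F := intervalIntegral.integral_nonneg hL0 fun _ _ => by positivity
  have hU0 : 0 ≤ U := intervalIntegral.integral_nonneg hL0 fun _ _ => by positivity
  have hY0 : 0 ≤ ∫ t in (0:ℝ)..L, ‖f t - α * u t‖ ^ 2 :=
    intervalIntegral.integral_nonneg hL0 fun _ _ => by positivity
  have hl0 : 0 < l := by linarith
  have hθ4 : ‖θ‖ ≤ 1 / 4 := hθ.trans (by
    apply one_div_le_one_div_of_le <;> linarith)
  have hθ0 := norm_nonneg θ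
  have ha0 : 0 < a := by
    by_contra h
    push Not at h
    nlinarith
  have ha1 : a ≤ 4 / 3 * α := by nlinarith
  have hU1 : α ^ 2 * U ≤ F := by linarith
  have hY1 : (∫ t in (0:ℝ)..L, ‖f t - α * u t‖ ^ 2) ≤ F := by nlinarith [mul_nonneg (sq_nonneg α) hU0]
  have rY := deb_restrict (fun t => ‖f t - α * u t‖ ^ 2) (by fun_prop) (fun _ => by positivity) L τ hτ hL
  have rU := deb_restrict (fun t => ‖u t‖ ^ 2) (by fun_prop) (fun _ => by positivity) L τ hτ hL
  have rF := deb_restrict (fun t => ‖f t‖ ^ 2) (by fun_prop) (fun _ => by positivity) L τ hτ hL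
  have sU := deb_shift (fun t => ‖u t‖ ^ 2) (by fun_prop) (fun _ => by positivity) L τ hτ hL
  have sF := deb_shift (fun t => ‖f t‖ ^ 2) (by fun_prop) (fun _ => by positivity) L τ hτ hL
  have hb : 0 ≤ L - τ := by linarith
  rw [← hU] at rU sU
  rw [← hF] at rF sF
  constructor
  · have hpt : ∀ t, ‖f t - a * (u t - θ * u (t + τ))‖ ^ 2 ≤
        (1 + 1 / l) * ‖f t - α * u t‖ ^ 2 + ((1 + l) * 2 * (a * ‖θ‖) ^ 2) * ‖u t‖ ^ 2
          + ((1 + l) * 2 * (a * ‖θ‖) ^ 2) * ‖u (t + τ)‖ ^ 2 := by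
      intro t
      have h1 := deb_norm_add_sq (1 / l) (by positivity) (f t - α * u t)
        (-((a * ‖θ‖ : ℝ) : ℂ) * u t + a * θ * u (t + τ))
      have h2 := deb_norm_add_sq 1 one_pos (-((a * ‖θ‖ : ℝ) : ℂ) * u t) (a * θ * u (t + τ))
      have e1 : ‖-((a * ‖θ‖ : ℝ) : ℂ) * u t‖ = a * ‖θ‖ * ‖u t‖ := by
        rw [norm_mul, norm_neg, Complex.norm_real, Real.norm_of_nonneg (by positivity)]
      have e2 : ‖(a : ℂ) * θ * u (t + τ)‖ = a * ‖θ‖ * ‖u (t + τ)‖ := by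
        rw [norm_mul, norm_mul, Complex.norm_real, Real.norm_of_nonneg (by positivity)]
      rw [e1, e2] at h2
      have e3 : f t - α * u t + (-((a * ‖θ‖ : ℝ) : ℂ) * u t + a * θ * u (t + τ))
          = f t - a * (u t - θ * u (t + τ)) := by
        rw [← ha]; push_cast; ring
      rw [e3] at h1
      have e4 : 1 + 1 / (1 / l) = 1 + l := by field_simp
      rw [e4] at h1
      refine h1.trans ?_
      have := mul_le_mul_of_nonneg_left h2 (by linarith : 0 ≤ 1 + l)
      nlinarith
    have := deb_int3 _ _ _ _ _ _ (by fun_prop) (by fun_prop) (by fun_prop) _ (by fun_prop) _ hb hpt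
    refine this.trans ?_
    have hq : a * ‖θ‖ ≤ α / (3 * l) := by
      have : a * ‖θ‖ ≤ 4 / 3 * α * (1 / (4 * l)) := by gcongr
      refine this.trans (le_of_eq ?_)
      field_simp
    have hq2 : (1 + l) * 2 * (a * ‖θ‖) ^ 2 ≤ (1 / (2 * l)) * α ^ 2 := by
      have h1 : (a * ‖θ‖) ^ 2 ≤ (α / (3 * l)) ^ 2 := by gcongr
      have h2 : (1 + l) * 2 * (a * ‖θ‖) ^ 2 ≤ (2 * l) * 2 * (α / (3 * l)) ^ 2 := by
        gcongr; linarith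
      refine h2.trans ?_
      have : (2 * l) * 2 * (α / (3 * l)) ^ 2 = (4 / 9) * (α ^ 2 / l) := by field_simp; ring
      rw [this]
      have : 1 / (2 * l) * α ^ 2 = 1 / 2 * (α ^ 2 / l) := by field_simp
      rw [this]
      have : 0 ≤ α ^ 2 / l := by positivity
      linarith
    calc _ ≤ (1 + 1 / l) * F + ((1 + l) * 2 * (a * ‖θ‖) ^ 2) * U
          + ((1 + l) * 2 * (a * ‖θ‖) ^ 2) * U := by
            gcongr
            exact rY.trans hY1
      _ ≤ (1 + 1 / l) * F + ((1 / (2 * l)) * α ^ 2) * U + ((1 / (2 * l)) * α ^ 2) * U := by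
            gcongr
      _ = (1 + 1 / l) * F + 1 / l * (α ^ 2 * U) := by field_simp; ring
      _ ≤ (1 + 1 / l) * F + 1 / l * F := by gcongr
      _ = _ := by ring
  · have hpt : ∀ t, ‖(a : ℂ) * (((α : ℂ) + lam * Complex.I) * (u t - θ * u (t + τ)) - f t
          + θ * f (t + τ))‖ ^ 2 ≤
        (2 * α ^ 2) * (12 * α ^ 2 * ‖u t‖ ^ 2 + 3 * ‖f t‖ ^ 2) +
        (2 * α ^ 2) * (12 * α ^ 2 * ‖u (t + τ)‖ ^ 2) +
        (2 * α ^ 2) * (3 * ‖f (t + τ)‖ ^ 2) := by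
      intro t
      rw [norm_mul, mul_pow, Complex.norm_real, Real.norm_of_nonneg ha0.le]
      have hβ : ‖(α : ℂ) + lam * Complex.I‖ ^ 2 ≤ 2 * α ^ 2 := by
        rw [Complex.sq_norm, Complex.normSq_add_mul_I]
        have := sq_le_sq' (by linarith [abs_nonneg lam]) hlam
        rw [sq_abs] at this
        linarith
      have h1 := norm_sub_le (u t) (θ * u (t + τ))
      rw [norm_mul] at h1
      have h2 : ‖((α : ℂ) + lam * Complex.I) * (u t - θ * u (t + τ)) - f t
          + θ * f (t + τ)‖ ≤ ‖(α : ℂ) + lam * Complex.I‖ * ‖(u t - θ * u (t + τ))‖ + ‖f t‖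
            + ‖f (t + τ)‖ := by
        refine (norm_add_le _ _).trans (add_le_add ((norm_sub_le _ _).trans ?_) ?_)
        · rw [norm_mul]
        · rw [norm_mul]; nlinarith [norm_nonneg (f (t + τ))]
      have h3 : ‖u t - θ * u (t + τ)‖ ≤ ‖u t‖ + ‖u (t + τ)‖ := by
        nlinarith [norm_nonneg (u (t + τ))]
      have h4 : ‖u t - θ * u (t + τ)‖ ^ 2 ≤ 2 * (‖u t‖ ^ 2 + ‖u (t + τ)‖ ^ 2) := by
        have : ‖u t - θ * u (t + τ)‖ ^ 2 ≤ (‖u t‖ + ‖u (t + τ)‖) ^ 2 := by gcongr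
        nlinarith [sq_nonneg (‖u t‖ - ‖u (t + τ)‖)]
      have h5 : ‖((α : ℂ) + lam * Complex.I) * (u t - θ * u (t + τ)) - f t
          + θ * f (t + τ)‖ ^ 2 ≤ 3 * (‖(α : ℂ) + lam * Complex.I‖ ^ 2 * ‖(u t - θ * u (t + τ))‖ ^ 2
            + ‖f t‖ ^ 2 + ‖f (t + τ)‖ ^ 2) := by
        have : ‖((α : ℂ) + lam * Complex.I) * (u t - θ * u (t + τ)) - f t
          + θ * f (t + τ)‖ ^ 2 ≤ (‖(α : ℂ) + lam * Complex.I‖ * ‖(u t - θ * u (t + τ))‖ + ‖f t‖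
            + ‖f (t + τ)‖) ^ 2 := by gcongr
        set X := ‖(α : ℂ) + lam * Complex.I‖ * ‖(u t - θ * u (t + τ))‖ with hX
        have hX2 : ‖(α : ℂ) + lam * Complex.I‖ ^ 2 * ‖(u t - θ * u (t + τ))‖ ^ 2 = X ^ 2 := by
          rw [hX]; ring
        rw [hX2]
        have h3sq : ∀ p q r : ℝ, (p + q + r) ^ 2 ≤ 3 * (p ^ 2 + q ^ 2 + r ^ 2) := by
          intro p q r
          linarith [sq_nonneg (p - q), sq_nonneg (p - r), sq_nonneg (q - r)]
        exact this.trans (h3sq _ _ _)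
      have h6 : ‖(α : ℂ) + lam * Complex.I‖ ^ 2 * ‖(u t - θ * u (t + τ))‖ ^ 2 ≤
          (2 * α ^ 2) * (2 * (‖u t‖ ^ 2 + ‖u (t + τ)‖ ^ 2)) := by gcongr
      have h7 : a ^ 2 ≤ 2 * α ^ 2 := by
        have : a ^ 2 ≤ (4 / 3 * α) ^ 2 := by gcongr
        nlinarith
      calc _ ≤ (2 * α ^ 2) * (3 * ((2 * α ^ 2) * (2 * (‖u t‖ ^ 2 + ‖u (t + τ)‖ ^ 2))
            + ‖f t‖ ^ 2 + ‖f (t + τ)‖ ^ 2)) := by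
              gcongr
              exact h5.trans (by gcongr)
        _ = _ := by ring
    have := deb_int3 _ _ _ (fun t => 12 * α ^ 2 * ‖u t‖ ^ 2 + 3 * ‖f t‖ ^ 2)
      (fun t => 12 * α ^ 2 * ‖u (t + τ)‖ ^ 2) (fun t => 3 * ‖f (t + τ)‖ ^ 2)
      (by fun_prop) (by fun_prop) (by fun_prop) _ (by fun_prop) _ hb hpt
    refine this.trans ?_
    rw [intervalIntegral.integral_add (Continuous.intervalIntegrable (by fun_prop) _ _)
      (Continuous.intervalIntegrable (by fun_prop) _ _)]
    simp only [intervalIntegral.integral_const_mul]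
    calc _ ≤ 2 * α ^ 2 * (12 * α ^ 2 * U + 3 * F) + 2 * α ^ 2 * (12 * α ^ 2 * U)
          + 2 * α ^ 2 * (3 * F) := by gcongr
      _ = (2 * α ^ 2) * (24 * (α ^ 2 * U) + 6 * F) := by ring
      _ ≤ (2 * α ^ 2) * (24 * F + 6 * F) := by gcongr
      _ = _ := by ring

noncomputable def debS (l : ℕ) (lam : ℕ → ℝ) (c : ℕ → ℂ) (t : ℝ) : ℂ :=
  ∑ j ∈ Finset.range l, c j * Complex.exp (Complex.I * lam j * t)

noncomputable def debD (l : ℕ) (lam : ℕ → ℝ) (c : ℕ → ℂ) (t : ℝ) : ℂ :=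
  ∑ j ∈ Finset.range l, c j * (Complex.I * lam j * Complex.exp (Complex.I * lam j * t))

noncomputable def debM (α τ a x y : ℝ) : ℂ :=
  1 - a * ((1 - Complex.exp (-(α + x * Complex.I) * τ) * Complex.exp (Complex.I * y * τ))
    / (α + x * Complex.I - Complex.I * y))

lemma debS_cont (l : ℕ) (lam : ℕ → ℝ) (c : ℕ → ℂ) : Continuous (debS l lam c) := by
  unfold debS; fun_prop

lemma debD_cont (l : ℕ) (lam : ℕ → ℝ) (c : ℕ → ℂ) : Continuous (debD l lam c) := by
  unfold debD; fun_prop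

lemma deb_exp_deriv (b : ℂ) (t : ℝ) :
    HasDerivAt (fun t : ℝ => Complex.exp (b * t)) (b * Complex.exp (b * t)) t := by
  have h : HasDerivAt (fun t : ℝ => b * (t : ℂ)) (b * 1) t :=
    (Complex.ofRealCLM.hasDerivAt (x := t)).const_mul b
  have := h.cexp
  convert this using 1
  ring

lemma debS_deriv (l : ℕ) (lam : ℕ → ℝ) (c : ℕ → ℂ) (t : ℝ) :
    HasDerivAt (debS l lam c) (debD l lam c t) t := by
  unfold debS debD
  exact HasDerivAt.fun_sum fun j _ => (deb_exp_deriv _ t).const_mul _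

lemma deb_step2 (l : ℕ) (hl : 1 ≤ l) (lam : ℕ → ℝ) (c : ℕ → ℂ) (α x L τ a : ℝ) (hα : 0 < α)
    (hx : |x| ≤ α) (hτ : 0 ≤ τ) (hL : τ ≤ L)
    (hθ : Real.exp (-(α * τ)) ≤ 1 / (4 * l)) (ha : a * (1 - Real.exp (-(α * τ))) = α) :
    (∫ t in (0:ℝ)..(L-τ), ‖debS l lam (fun j => c j * debM α τ a x (lam j)) t‖ ^ 2)
        ≤ (1 + 2 / l) * ∫ t in (0:ℝ)..L, ‖debS l lam c t‖ ^ 2 ∧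
    (∫ t in (0:ℝ)..(L-τ), ‖debD l lam c t - debD l lam (fun j => c j * debM α τ a x (lam j)) t‖ ^ 2)
        ≤ (60 * α ^ 2) * ∫ t in (0:ℝ)..L, ‖debS l lam c t‖ ^ 2 := by
  set β : ℂ := α + x * Complex.I with hβ
  set θ : ℂ := Complex.exp (-β * τ) with hθd
  have hne : ∀ y : ℝ, β - Complex.I * y ≠ 0 := by
    intro y h
    have := congrArg Complex.re h
    simp [hβ] at this
    exact hα.ne' this
  let u : ℝ → ℂ := fun t => ∑ j ∈ Finset.range l, c j * ((Complex.exp (Complex.I * lam j * t)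
    - Complex.exp (Complex.I * lam j * L - β * L) * Complex.exp (β * t)) / (β - Complex.I * lam j))
  have hnθ : ‖θ‖ = Real.exp (-(α * τ)) := by
    rw [hθd, Complex.norm_exp]
    simp [hβ]
  have hu : ∀ t, HasDerivAt u (β * u t - debS l lam c t) t := by
    intro t
    have h1 : HasDerivAt u (∑ j ∈ Finset.range l, c j * ((Complex.I * lam j * Complex.exp (Complex.I * lam j * t)
      - Complex.exp (Complex.I * lam j * L - β * L) * (β * Complex.exp (β * t))) / (β - Complex.I * lam j))) t :=
      HasDerivAt.fun_sum fun j _ => (((deb_exp_deriv _ t).sub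
        ((deb_exp_deriv _ t).const_mul _)).div_const _).const_mul _
    convert h1 using 1
    simp only [u, debS, Finset.mul_sum, ← Finset.sum_sub_distrib]
    refine Finset.sum_congr rfl fun j _ => ?_
    have := hne (lam j)
    field_simp
    ring
  have huL : u L = 0 := by
    simp only [u]
    refine Finset.sum_eq_zero fun j _ => ?_
    rw [← Complex.exp_add]
    simp
  have key := deb_step (debS l lam c) u α x L τ l a θ hα hx hτ hL (debS_cont _ _ _)
    (by exact_mod_cast hl) hu huL (by rw [hnθ]; exact hθ) (by rw [hnθ]; exact ha)
  have hv : ∀ t : ℝ, u t - θ * u (t + τ) = ∑ j ∈ Finset.range l,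
      c j * Complex.exp (Complex.I * lam j * t) * ((1 - θ * Complex.exp (Complex.I * lam j * τ))
    / (β - Complex.I * lam j)) := by
    intro t
    simp only [u, Finset.mul_sum, ← Finset.sum_sub_distrib]
    refine Finset.sum_congr rfl fun j _ => ?_
    have h1 : θ * Complex.exp (β * ((t + τ : ℝ) : ℂ)) = Complex.exp (β * t) := by
      rw [hθd, ← Complex.exp_add]; congr 1; push_cast; ring
    have h2 : Complex.exp (Complex.I * lam j * ((t + τ : ℝ) : ℂ)) =
      Complex.exp (Complex.I * lam j * t) * Complex.exp (Complex.I * lam j * τ) := by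
      rw [← Complex.exp_add]; congr 1; push_cast; ring
    have := hne (lam j)
    rw [h2, ← h1]
    field_simp
    ring
  have e1 : ∀ t : ℝ, debS l lam c t - a * (u t - θ * u (t + τ)) =
      debS l lam (fun j => c j * debM α τ a x (lam j)) t := by
    intro t
    rw [hv]
    simp only [debS, Finset.mul_sum, ← Finset.sum_sub_distrib]
    refine Finset.sum_congr rfl fun j _ => ?_
    simp only [debM, ← hβ, ← hθd]
    ring
  have e2 : ∀ t : ℝ, (a : ℂ) * (β * (u t - θ * u (t + τ)) - debS l lam c t
          + θ * debS l lam c (t + τ)) =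
      debD l lam c t - debD l lam (fun j => c j * debM α τ a x (lam j)) t := by
    intro t
    rw [hv]
    simp only [debS, debD, Finset.mul_sum, ← Finset.sum_sub_distrib, ← Finset.sum_add_distrib]
    refine Finset.sum_congr rfl fun j _ => ?_
    simp only [debM, ← hβ, ← hθd]
    have h2 : Complex.exp (Complex.I * lam j * ((t + τ : ℝ) : ℂ)) =
      Complex.exp (Complex.I * lam j * t) * Complex.exp (Complex.I * lam j * τ) := by
      rw [← Complex.exp_add]; congr 1; push_cast; ring
    have := hne (lam j)
    rw [h2]
    field_simp
    ring
  simp only [← hβ] at key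
  simp_rw [e1, e2] at key
  exact key

lemma deb_half (l : ℕ) (hl : 1 ≤ l) (lam : ℕ → ℝ) (c : ℕ → ℂ) (hlam : ∀ j, |lam j| ≤ 8) :
    (∫ t in (0:ℝ)..(1/2), ‖debD l lam c t‖ ^ 2)
      ≤ 34560 * (l:ℝ) ^ 6 * ∫ t in (0:ℝ)..1, ‖debS l lam c t‖ ^ 2 := by
  have hl1 : (1:ℝ) ≤ l := by exact_mod_cast hl
  have hl0 : (0:ℝ) < l := by linarith
  set α : ℝ := 8 * (l:ℝ) ^ 2 with hα
  set τ : ℝ := 1 / (2 * l) with hτ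
  set a : ℝ := α / (1 - Real.exp (-(α * τ))) with ha
  have hα8 : 8 ≤ α := by rw [hα]; nlinarith
  have hα0 : 0 < α := by linarith
  have hτ0 : 0 < τ := by positivity
  have hατ : α * τ = 4 * l := by rw [hα, hτ]; field_simp; norm_num
  have hθ : Real.exp (-(α * τ)) ≤ 1 / (4 * l) := by
    rw [hατ, Real.exp_neg, ← one_div]
    apply one_div_le_one_div_of_le (by positivity)
    have := Real.add_one_le_exp (4 * (l:ℝ))
    linarith
  have hθ1 : Real.exp (-(α * τ)) < 1 := by
    rw [Real.exp_lt_one_iff]; nlinarith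
  have haa : a * (1 - Real.exp (-(α * τ))) = α := by
    rw [ha]; field_simp [(by linarith : (1 - Real.exp (-(α * τ))) ≠ 0)]
  let C : ℕ → ℕ → ℂ := fun n j => c j * ∏ i ∈ Finset.range n, debM α τ a (lam i) (lam j)
  have hC : ∀ n, C (n + 1) = fun j => C n j * debM α τ a (lam n) (lam j) := by
    intro n; funext j; simp only [C, Finset.prod_range_succ]; ring
  have hC0 : C 0 = c := by funext j; simp [C]
  set F := ∫ t in (0:ℝ)..1, ‖debS l lam c t‖ ^ 2 with hF
  have hF0 : 0 ≤ F := intervalIntegral.integral_nonneg (by norm_num) fun _ _ => by positivity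
  have hM0 : ∀ x, debM α τ a x x = 0 := by
    intro x
    have h1 : Complex.exp (-(α + x * Complex.I) * τ) * Complex.exp (Complex.I * x * τ)
        = ((Real.exp (-(α * τ)) : ℝ) : ℂ) := by
      rw [← Complex.exp_add]; push_cast; congr 1; ring
    have h2 : (α + x * Complex.I - Complex.I * x : ℂ) = α := by ring
    rw [debM, h1, h2]
    have h3 : (α : ℂ) ≠ 0 := by exact_mod_cast hα0.ne'
    have h4 : (a : ℂ) * (1 - ((Real.exp (-(α * τ)) : ℝ) : ℂ)) = α := by exact_mod_cast haa
    rw [← mul_div_assoc, h4, div_self h3, sub_self]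
  have hDl : ∀ t, debD l lam (C l) t = 0 := by
    intro t
    refine Finset.sum_eq_zero fun j hj => ?_
    have : C l j = 0 := by
      simp only [C]
      rw [Finset.prod_eq_zero hj (hM0 _), mul_zero]
    rw [this, zero_mul]
  have hLn : ∀ n, n < l → ((n:ℝ) + 1) * τ ≤ 1 / 2 := by
    intro n hn
    have : (n:ℝ) + 1 ≤ l := by exact_mod_cast hn
    calc ((n:ℝ) + 1) * τ ≤ l * τ := by gcongr
      _ = 1 / 2 := by rw [hτ]; field_simp
  have hstep := fun n (hn : n < l) => deb_step2 l hl lam (C n) α (lam n) (1 - n * τ) τ a hα0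
    ((hlam n).trans hα8) hτ0.le (by have := hLn n hn; linarith) hθ haa
  simp_rw [← hC] at hstep
  have hE : ∀ n, n ≤ l → (∫ t in (0:ℝ)..(1 - n * τ), ‖debS l lam (C n) t‖ ^ 2)
      ≤ (1 + 2 / l) ^ n * F := by
    intro n
    induction n with
    | zero => intro _; simp [hC0, hF]
    | succ n ih =>
      intro hn
      have h1 := (hstep n hn).1
      have h2 := ih (by omega)
      have e : 1 - ((n + 1 : ℕ) : ℝ) * τ = 1 - n * τ - τ := by push_cast; ring
      rw [e]
      refine h1.trans ?_
      rw [pow_succ', mul_assoc]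
      gcongr
  have h9 : ∀ n, n ≤ l → (1 + 2 / (l:ℝ)) ^ n ≤ 9 := by
    intro n hn
    have h1 : (1 + 2 / (l:ℝ)) ^ n ≤ (1 + 2 / (l:ℝ)) ^ l :=
      pow_le_pow_right₀ (by have : 0 < 2 / (l:ℝ) := by positivity
                            linarith) hn
    have h2 : (1 + 2 / (l:ℝ)) ≤ Real.exp (2 / l) := by
      have := Real.add_one_le_exp (2 / (l:ℝ)); linarith
    have h3 : (1 + 2 / (l:ℝ)) ^ l ≤ Real.exp (2 / l) ^ l := by gcongr
    have h4 : Real.exp (2 / l) ^ l = Real.exp 1 ^ 2 := by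
      rw [← Real.exp_nat_mul, ← Real.exp_nat_mul]; congr 1; field_simp; norm_num
    have h5 := Real.exp_one_lt_d9
    have h6 := Real.exp_pos 1
    nlinarith
  have hD : ∀ n, n < l → (∫ t in (0:ℝ)..(1/2), ‖debD l lam (C n) t - debD l lam (C (n+1)) t‖ ^ 2)
      ≤ 34560 * (l:ℝ) ^ 4 * F := by
    intro n hn
    have h1 := (hstep n hn).2
    have h2 := hE n hn.le
    have h3 := h9 n hn.le
    have hcont : Continuous fun t => ‖debD l lam (C n) t - debD l lam (C (n+1)) t‖ ^ 2 := by
      have := debD_cont l lam (C n)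
      have := debD_cont l lam (C (n+1))
      fun_prop
    calc _ ≤ ∫ t in (0:ℝ)..(1 - n * τ - τ), ‖debD l lam (C n) t - debD l lam (C (n+1)) t‖ ^ 2 :=
          intervalIntegral.integral_mono_interval le_rfl (by norm_num)
            (by have := hLn n hn; linarith)
            (Filter.Eventually.of_forall fun t => by positivity) (hcont.intervalIntegrable _ _)
      _ ≤ _ := h1
      _ ≤ 60 * α ^ 2 * (9 * F) := by
          gcongr
          exact h2.trans (by gcongr)
      _ = _ := by rw [hα]; ring
  have htel : ∀ t, debD l lam c t = ∑ n ∈ Finset.range l,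
      (debD l lam (C n) t - debD l lam (C (n+1)) t) := by
    intro t
    rw [Finset.sum_range_sub' (fun n => debD l lam (C n) t), hDl, hC0, sub_zero]
  have hpt : ∀ t, ‖debD l lam c t‖ ^ 2 ≤ l * ∑ n ∈ Finset.range l,
      ‖debD l lam (C n) t - debD l lam (C (n+1)) t‖ ^ 2 := by
    intro t
    rw [htel]
    calc _ ≤ (∑ n ∈ Finset.range l, ‖debD l lam (C n) t - debD l lam (C (n+1)) t‖) ^ 2 := by
          gcongr; exact norm_sum_le _ _
      _ ≤ _ := by
          have := sq_sum_le_card_mul_sum_sq (s := Finset.range l)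
            (f := fun n => ‖debD l lam (C n) t - debD l lam (C (n+1)) t‖)
          simpa using this
  have hcont : ∀ n, Continuous fun t => ‖debD l lam (C n) t - debD l lam (C (n+1)) t‖ ^ 2 := by
    intro n
    have := debD_cont l lam (C n)
    have := debD_cont l lam (C (n+1))
    fun_prop
  have hcD := debD_cont l lam c
  calc _ ≤ ∫ t in (0:ℝ)..(1/2), (l:ℝ) * ∑ n ∈ Finset.range l,
      ‖debD l lam (C n) t - debD l lam (C (n+1)) t‖ ^ 2 :=
        intervalIntegral.integral_mono (by norm_num)
          (Continuous.intervalIntegrable (by fun_prop) _ _)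
          (Continuous.intervalIntegrable
            (continuous_const.mul (continuous_finsetSum _ fun n _ => hcont n)) _ _) hpt
    _ = l * ∑ n ∈ Finset.range l, ∫ t in (0:ℝ)..(1/2),
          ‖debD l lam (C n) t - debD l lam (C (n+1)) t‖ ^ 2 := by
        rw [intervalIntegral.integral_const_mul, intervalIntegral.integral_finsetSum]
        exact fun n _ => (hcont n).intervalIntegrable _ _
    _ ≤ l * ∑ n ∈ Finset.range l, 34560 * (l:ℝ) ^ 4 * F := by
        gcongr with n hn
        exact hD n (Finset.mem_range.1 hn)
    _ = _ := by
        rw [Finset.sum_const, Finset.card_range, nsmul_eq_mul]; ring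

lemma deb_full (l : ℕ) (hl : 1 ≤ l) (lam : ℕ → ℝ) (c : ℕ → ℂ) (hlam : ∀ j, |lam j| ≤ 8) :
    (∫ t in (0:ℝ)..1, ‖debD l lam c t‖ ^ 2)
      ≤ (300 * (l:ℝ) ^ 3) ^ 2 * ∫ t in (0:ℝ)..1, ‖debS l lam c t‖ ^ 2 := by
  have h1 := deb_half l hl lam c hlam
  have h2 := deb_half l hl (fun j => - lam j) (fun j => c j * Complex.exp (Complex.I * lam j))
    (by simpa using hlam)
  have hE : ∀ (j : ℕ) (t : ℝ), Complex.exp (Complex.I * lam j * ((1 - t : ℝ) : ℂ)) =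
      Complex.exp (Complex.I * lam j) * Complex.exp (Complex.I * ((-lam j : ℝ) : ℂ) * t) := by
    intro j t; rw [← Complex.exp_add]; congr 1; push_cast; ring
  have eS : ∀ t : ℝ, debS l (fun j => - lam j) (fun j => c j * Complex.exp (Complex.I * lam j)) t
      = debS l lam c (1 - t) := by
    intro t
    simp only [debS, hE]
    exact Finset.sum_congr rfl fun j _ => by ring
  have eD : ∀ t : ℝ, debD l (fun j => - lam j) (fun j => c j * Complex.exp (Complex.I * lam j)) t
      = - debD l lam c (1 - t) := by
    intro t
    simp only [debD, hE, ← Finset.sum_neg_distrib]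
    exact Finset.sum_congr rfl fun j _ => by push_cast; ring
  simp_rw [eS, eD, norm_neg] at h2
  rw [intervalIntegral.integral_comp_sub_left (fun t => ‖debD l lam c t‖ ^ 2),
    intervalIntegral.integral_comp_sub_left (fun t => ‖debS l lam c t‖ ^ 2)] at h2
  norm_num at h2
  have hcD := debD_cont l lam c
  have hi : ∀ a b, IntervalIntegrable (fun t => ‖debD l lam c t‖ ^ 2) MeasureTheory.volume a b :=
    fun a b => Continuous.intervalIntegrable (by fun_prop) _ _
  rw [← intervalIntegral.integral_add_adjacent_intervals (hi 0 (1/2)) (hi (1/2) 1)]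
  have hF0 : 0 ≤ ∫ t in (0:ℝ)..1, ‖debS l lam c t‖ ^ 2 :=
    intervalIntegral.integral_nonneg (by norm_num) fun _ _ => by positivity
  have : 0 ≤ (l:ℝ) ^ 6 * ∫ t in (0:ℝ)..1, ‖debS l lam c t‖ ^ 2 := by positivity
  nlinarith

lemma deb_interval (f f' : ℝ → ℂ) (hf : ∀ t, HasDerivAt f (f' t) t) (hc : Continuous f')
    (M : ℝ) (hM : 0 < M) (p q : ℝ) (hpq : p ≤ q) :
    (∫ t in p..q, ‖f t‖ ^ 2) ≤ (q - p) * ‖f p‖ ^ 2 +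
      (q - p) * ∫ t in p..q, (M * ‖f t‖ ^ 2 + 1 / M * ‖f' t‖ ^ 2) := by
  have hcf : Continuous f := continuous_iff_continuousAt.2 fun t => (hf t).continuousAt
  set K := ∫ t in p..q, (M * ‖f t‖ ^ 2 + 1 / M * ‖f' t‖ ^ 2) with hK
  have hpt : ∀ t ∈ Set.Icc p q, ‖f t‖ ^ 2 ≤ ‖f p‖ ^ 2 + K := by
    intro t ht
    have hint := intervalIntegral.integral_eq_sub_of_hasDerivAt (a := p) (b := t)
      (fun s _ => (hf s).norm_sq) (Continuous.intervalIntegrable (by fun_prop) _ _)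
    have h1 : (∫ s in p..t, 2 * inner ℝ (f s) (f' s)) ≤
        ∫ s in p..t, (M * ‖f s‖ ^ 2 + 1 / M * ‖f' s‖ ^ 2) := by
      refine intervalIntegral.integral_mono ht.1 (Continuous.intervalIntegrable (by fun_prop) _ _)
        (Continuous.intervalIntegrable (by fun_prop) _ _) fun s => ?_
      have h := real_inner_le_norm (f s) (f' s)
      have e : M * ‖f s‖ ^ 2 + 1 / M * ‖f' s‖ ^ 2 - 2 * (‖f s‖ * ‖f' s‖) =
        (M * ‖f s‖ - ‖f' s‖) ^ 2 / M := by field_simp; ring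
      have : 0 ≤ (M * ‖f s‖ - ‖f' s‖) ^ 2 / M := by positivity
      simp only
      linarith
    have h2 : (∫ s in p..t, (M * ‖f s‖ ^ 2 + 1 / M * ‖f' s‖ ^ 2)) ≤ K :=
      intervalIntegral.integral_mono_interval le_rfl ht.1 ht.2
        (Filter.Eventually.of_forall fun s => by positivity)
        (Continuous.intervalIntegrable (by fun_prop) _ _)
    linarith
  have := intervalIntegral.integral_mono_on (f := fun t => ‖f t‖ ^ 2)
    (g := fun _ => ‖f p‖ ^ 2 + K) (μ := MeasureTheory.volume) hpq
    (Continuous.intervalIntegrable (by fun_prop) _ _)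
    (Continuous.intervalIntegrable (by fun_prop) _ _) hpt
  rw [intervalIntegral.integral_const, smul_eq_mul] at this
  linarith

lemma deb_riemann (f f' : ℝ → ℂ) (hf : ∀ t, HasDerivAt f (f' t) t) (hc : Continuous f')
    (M : ℝ) (hM : 0 < M) (N : ℕ) (hN : 4 * M ≤ N)
    (hB : (∫ t in (0:ℝ)..1, ‖f' t‖ ^ 2) ≤ M ^ 2 * ∫ t in (0:ℝ)..1, ‖f t‖ ^ 2) :
    (N:ℝ) / 2 * (∫ t in (0:ℝ)..1, ‖f t‖ ^ 2) ≤ ∑ k ∈ Finset.range (N + 1), ‖f ((k:ℝ) / N)‖ ^ 2 := by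
  have hcf : Continuous f := continuous_iff_continuousAt.2 fun t => (hf t).continuousAt
  have hN0 : (0:ℝ) < N := by linarith
  have hsum : ∀ g : ℝ → ℝ, Continuous g → (∑ k ∈ Finset.range N,
      ∫ t in ((k:ℝ) / N)..(((k + 1 : ℕ):ℝ) / N), g t) = ∫ t in (0:ℝ)..1, g t := by
    intro g hg
    have := intervalIntegral.sum_integral_adjacent_intervals (f := g) (n := N)
      (a := fun k => (k:ℝ) / N) (μ := MeasureTheory.volume) (fun k _ => hg.intervalIntegrable _ _)
    rw [this]
    simp [hN0.ne']
  have hk : ∀ k : ℕ, (∫ t in ((k:ℝ) / N)..(((k + 1 : ℕ):ℝ) / N), ‖f t‖ ^ 2) ≤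
      1 / N * ‖f ((k:ℝ) / N)‖ ^ 2 + 1 / N * ∫ t in ((k:ℝ) / N)..(((k + 1 : ℕ):ℝ) / N),
        (M * ‖f t‖ ^ 2 + 1 / M * ‖f' t‖ ^ 2) := by
    intro k
    have := deb_interval f f' hf hc M hM ((k:ℝ) / N) (((k + 1 : ℕ):ℝ) / N)
      (by gcongr; simp)
    have e : (((k + 1 : ℕ):ℝ) / N) - (k:ℝ) / N = 1 / N := by push_cast; ring
    rwa [e] at this
  have h := Finset.sum_le_sum fun k (_ : k ∈ Finset.range N) => hk k
  rw [hsum _ (by fun_prop), Finset.sum_add_distrib, ← Finset.mul_sum, ← Finset.mul_sum,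
    hsum _ (by fun_prop), intervalIntegral.integral_add
      (Continuous.intervalIntegrable (by fun_prop) _ _)
      (Continuous.intervalIntegrable (by fun_prop) _ _), intervalIntegral.integral_const_mul,
      intervalIntegral.integral_const_mul] at h
  set F := ∫ t in (0:ℝ)..1, ‖f t‖ ^ 2 with hF
  set G := ∫ t in (0:ℝ)..1, ‖f' t‖ ^ 2 with hG
  have hF0 : 0 ≤ F := intervalIntegral.integral_nonneg (by norm_num) fun _ _ => by positivity
  rw [Finset.sum_range_succ]
  set S := ∑ k ∈ Finset.range N, ‖f ((k:ℝ) / N)‖ ^ 2 with hS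
  have h1 : 1 / M * G ≤ M * F := by
    rw [one_div, inv_mul_le_iff₀ hM]; linarith
  have h2 : F ≤ 1 / N * S + 1 / N * (2 * M * F) := by
    refine h.trans ?_
    gcongr
    linarith
  have h3 : N * F ≤ S + 2 * M * F := by
    have := mul_le_mul_of_nonneg_left h2 hN0.le
    have e : (N:ℝ) * (1 / N * S + 1 / N * (2 * M * F)) = S + 2 * M * F := by field_simp
    linarith
  have h4 : 4 * M * F ≤ N * F := by gcongr
  have h5 : 0 ≤ ‖f ((N:ℝ) / N)‖ ^ 2 := by positivity
  linarith

/-- Discrete sampling dominates continuous energy: there is an absolute constant `C > 0`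
such that for any exponential sum `Q(u) = ∑_{j=1}^ℓ c_j e^{i N u x_j}` whose frequency
differences satisfy `|x_j − x_k| ≤ τΔ` with `τNΔ ≤ 2π`, and any integer
`N ≥ 2Cℓ⁹` (a threshold depending only on `ℓ`),
`∑_{k=0}^N |Q(k/N)|² ≥ (N/2) ∫_0^1 |Q(u)|² du`. -/
theorem discrete_energy_bound :
    ∃ C : ℝ, 0 < C ∧
      ∀ (ℓ N : ℕ) (τ Δ : ℝ) (x : Fin ℓ → ℝ) (c : Fin ℓ → ℂ),
        1 ≤ ℓ →
        (∀ j k, |x j - x k| ≤ τ * Δ) →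
        τ * N * Δ ≤ 2 * Real.pi →
        2 * C * (ℓ : ℝ) ^ 9 ≤ (N : ℝ) →
        ((N : ℝ) / 2) *
            ∫ u in (0:ℝ)..1, ‖∑ j, c j * Complex.exp (Complex.I * N * u * x j)‖ ^ 2 ≤
          ∑ k ∈ Finset.range (N + 1),
            ‖∑ j, c j * Complex.exp (Complex.I * N * ((k : ℝ) / N) * x j)‖ ^ 2 := by
  refine ⟨600, by norm_num, ?_⟩
  intro l N τ Δ x c hl hx hτ hN
  have hl1 : (1:ℝ) ≤ l := by exact_mod_cast hl
  let x0 : ℝ := x ⟨0, hl⟩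
  let lam : ℕ → ℝ := fun j => if h : j < l then N * (x ⟨j, h⟩ - x0) else 0
  let c' : ℕ → ℂ := fun j => if h : j < l then c ⟨j, h⟩ else 0
  have hlam : ∀ j, |lam j| ≤ 8 := by
    intro j
    by_cases h : j < l
    · simp only [lam, h, dif_pos]
      rw [abs_mul, Nat.abs_cast]
      have h1 : (N:ℝ) * |x ⟨j, h⟩ - x0| ≤ N * (τ * Δ) := by
        gcongr; exact hx _ _
      have := Real.pi_le_four
      nlinarith
    · simp [lam, h]
  have hQ : ∀ u : ℝ, ‖∑ j, c j * Complex.exp (Complex.I * N * u * x j)‖ = ‖debS l lam c' u‖ := by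
    intro u
    have e : (∑ j, c j * Complex.exp (Complex.I * N * u * x j)) =
        Complex.exp (((N * u * x0 : ℝ) : ℂ) * Complex.I) * debS l lam c' u := by
      rw [debS, Finset.mul_sum, Finset.sum_range]
      refine Finset.sum_congr rfl fun j _ => ?_
      simp only [lam, c', j.2, dif_pos]
      rw [mul_left_comm, ← Complex.exp_add]
      congr 2
      push_cast
      ring
    rw [e, norm_mul, Complex.norm_exp_ofReal_mul_I, one_mul]
  have hM : 4 * (300 * (l:ℝ) ^ 3) ≤ N := by
    have : (l:ℝ) ^ 3 ≤ (l:ℝ) ^ 9 := pow_le_pow_right₀ hl1 (by norm_num)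
    linarith
  have key := deb_riemann (debS l lam c') (debD l lam c') (debS_deriv l lam c')
    (debD_cont l lam c') (300 * (l:ℝ) ^ 3) (by positivity) N hM (deb_full l hl lam c' hlam)
  have hQ' : ∀ k : ℕ, ‖∑ j, c j * Complex.exp (Complex.I * N * ((k : ℝ) / N) * x j)‖
      = ‖debS l lam c' ((k:ℝ) / N)‖ := by
    intro k
    rw [← hQ]
    push_cast
    rfl
  simp_rw [hQ, hQ']
  exact key
end
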